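/- arXiv:2002.11234 — 5 statements merged into one kernel-verified Lean document; each statement's English description precedes it below -/
import Mathlib

section
/- With ℓ = d/N and s = 1 − 1/N, the modified lackadaisical walk and Szegedy's quantum walk of the interpolated lazy random walk are exactly conjugate under the partial isometry E: Û_lazy = E · W(P̂(s)) · E†, where E† is the adjoint of E. -/
open scoped BigOperators ComplexConjugate
open Complex

set_option linter.unusedSectionVars false

noncomputable section

namespace LQWPaper

variable {V : Type*} [Fintype V] [DecidableEq V]

/-- The inner product `⟨v,w⟩ = Σᵢ conj (v i) * w i` on `ι → ℂ`. -/
def cip {ι : Type*} [Fintype ι] (v w : ι → ℂ) : ℂ :=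
  ∑ i, (starRingEnd ℂ) (v i) * w i

/-- The `ℓ₂`-norm on `ι → ℂ`. -/
def l2norm {ι : Type*} [Fintype ι] (v : ι → ℂ) : ℝ :=
  Real.sqrt (∑ i, Complex.normSq (v i))

/-- The operator norm (with respect to the `ℓ₂`-norm) of a square matrix. -/
def opNorm {ι : Type*} [Fintype ι] (M : Matrix ι ι ℂ) : ℝ :=
  sSup {r : ℝ | ∃ v : ι → ℂ, l2norm v = 1 ∧ r = l2norm (M.mulVec v)}

/-- A fixed labeling `y_1(x), …, y_d(x)` of the `d` neighbors of each vertex of a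
`d`-regular graph: a bijection from `Fin d` to the neighbor set of each vertex. -/
structure Labeling (G : SimpleGraph V) (d : ℕ) where
  nbr : (x : V) → Fin d ≃ (G.neighborSet x)

lemma Labeling.adj {G : SimpleGraph V} {d : ℕ} (L : Labeling G d) (x : V) (i : Fin d) :
    G.Adj x (L.nbr x i) := (L.nbr x i).prop

/-- The (unique) index of `x` among the neighbors of `y`. -/
def Labeling.idx {G : SimpleGraph V} {d : ℕ} (L : Labeling G d) (y x : V)
    (h : G.Adj y x) : Fin d := (L.nbr y).symm ⟨x, h⟩

/-- The flip-flop shift on basis states: `|x, e_i⟩ ↦ |y, e_j⟩` where `y = y_i(x)` and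
`x = y_j(y)`, and `|x, ↻⟩ ↦ |x, ↻⟩`.  The self-loop is the coin index `Fin.last d`. -/
def shiftFun {G : SimpleGraph V} {d : ℕ} (L : Labeling G d)
    (p : V × Fin (d + 1)) : V × Fin (d + 1) :=
  if h : p.2 = Fin.last d then p
  else
    let i : Fin d := p.2.castPred h
    ⟨L.nbr p.1 i, Fin.castSucc (L.idx (L.nbr p.1 i) p.1 ((L.adj p.1 i).symm))⟩

/-- The flip-flop shift operator `S` as a matrix. -/
def shiftMat {G : SimpleGraph V} {d : ℕ} (L : Labeling G d) :
    Matrix (V × Fin (d + 1)) (V × Fin (d + 1)) ℂ :=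
  Matrix.of fun p q => if p = shiftFun L q then 1 else 0

/-- The coin state `|c⟩ = (1/√(d+ℓ)) (|e_1⟩ + ⋯ + |e_d⟩ + √ℓ |↻⟩)`. -/
def coinVec (d : ℕ) (ℓ : ℝ) : Fin (d + 1) → ℂ :=
  fun a => if a = Fin.last d then ((Real.sqrt ℓ / Real.sqrt (d + ℓ) : ℝ) : ℂ)
           else ((1 / Real.sqrt (d + ℓ) : ℝ) : ℂ)

/-- The coin operator `C = 2|c⟩⟨c| − I`. -/
def coinMat (d : ℕ) (ℓ : ℝ) : Matrix (Fin (d + 1)) (Fin (d + 1)) ℂ :=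
  (2 : ℂ) • Matrix.of (fun a b => coinVec d ℓ a * (starRingEnd ℂ) (coinVec d ℓ b)) - 1

/-- The global coin operator `I_N ⊗ C`. -/
def coinLift (d : ℕ) (ℓ : ℝ) :
    Matrix (V × Fin (d + 1)) (V × Fin (d + 1)) ℂ :=
  Matrix.of fun p q => if p.1 = q.1 then coinMat d ℓ p.2 q.2 else 0

/-- The oracle `G_or = (I_N − 2|m⟩⟨m|) ⊗ I_{d+1}`. -/
def oracleMat (d : ℕ) (m : V) : Matrix (V × Fin (d + 1)) (V × Fin (d + 1)) ℂ :=
  Matrix.of fun p q => if p = q then (if p.1 = m then -1 else 1) else 0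

/-- The lackadaisical quantum walk `U_lazy = S · (I_N ⊗ C) · G_or`. -/
def Ulazy {G : SimpleGraph V} {d : ℕ} (L : Labeling G d) (m : V) (ℓ : ℝ) :
    Matrix (V × Fin (d + 1)) (V × Fin (d + 1)) ℂ :=
  shiftMat L * coinLift d ℓ * oracleMat d m

/-- The initial state `|init_lazy⟩ = (1/√(N−1)) Σ_{x ≠ m} |x⟩ ⊗ |c⟩`. -/
def initLazy (m : V) (d : ℕ) (ℓ : ℝ) : V × Fin (d + 1) → ℂ :=
  fun p => if p.1 = m then 0
    else ((1 / Real.sqrt ((Fintype.card V : ℝ) - 1) : ℝ) : ℂ) * coinVec d ℓ p.2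

/-- The state `|⇒⟩ = (1/√d)(|e_1⟩ + ⋯ + |e_d⟩)`. -/
def plusVec (d : ℕ) : Fin (d + 1) → ℂ :=
  fun a => if a = Fin.last d then 0 else ((1 / Real.sqrt d : ℝ) : ℂ)

/-- The modified oracle `Ĝ_or = I − 2(|m,↻⟩⟨m,↻| + |m,⇒⟩⟨m,⇒|)`. -/
def oracleHat (d : ℕ) (m : V) : Matrix (V × Fin (d + 1)) (V × Fin (d + 1)) ℂ :=
  1 - (2 : ℂ) • Matrix.of (fun p q =>
    (if p = (m, Fin.last d) ∧ q = (m, Fin.last d) then 1 else 0)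
    + (if p.1 = m ∧ q.1 = m then plusVec d p.2 * (starRingEnd ℂ) (plusVec d q.2) else 0))

/-- The modified lackadaisical quantum walk `Û_lazy = S · (I_N ⊗ C) · Ĝ_or`. -/
def UlazyHat {G : SimpleGraph V} {d : ℕ} (L : Labeling G d) (m : V) (ℓ : ℝ) :
    Matrix (V × Fin (d + 1)) (V × Fin (d + 1)) ℂ :=
  shiftMat L * coinLift d ℓ * oracleHat d m

/-- The action of an automorphism `σ` of `G` on arcs and self-loops:
`P_σ |x, e_i⟩ = |σ x, e_j⟩` with `y_j(σ x) = σ (y_i x)`, and `P_σ |x, ↻⟩ = |σ x, ↻⟩`. -/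
def permFun {G : SimpleGraph V} {d : ℕ} (L : Labeling G d) (σ : G ≃g G)
    (p : V × Fin (d + 1)) : V × Fin (d + 1) :=
  if h : p.2 = Fin.last d then (σ p.1, p.2)
  else
    let i : Fin d := p.2.castPred h
    ⟨σ p.1, Fin.castSucc (L.idx (σ p.1) (σ (L.nbr p.1 i)) (σ.map_adj_iff.mpr (L.adj p.1 i)))⟩

/-- The unitary `P_σ` induced by an automorphism `σ` of `G`, as a matrix. -/
def permMat {G : SimpleGraph V} {d : ℕ} (L : Labeling G d) (σ : G ≃g G) :
    Matrix (V × Fin (d + 1)) (V × Fin (d + 1)) ℂ :=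
  Matrix.of fun p q => if p = permFun L σ q then 1 else 0

/-- `G` is locally arc-transitive if for any vertex `u` with neighbors `v₁, v₂` there is an
automorphism of `G` fixing `u` and mapping `v₁` to `v₂`. -/
def LocallyArcTransitive (G : SimpleGraph V) : Prop :=
  ∀ u v₁ v₂ : V, G.Adj u v₁ → G.Adj u v₂ → ∃ σ : G ≃g G, σ u = u ∧ σ v₁ = v₂

/-- The transition matrix `P` of the simple random walk on a `d`-regular graph. -/
def Pmat (G : SimpleGraph V) [DecidableRel G.Adj] (d : ℕ) : Matrix V V ℝ :=
  Matrix.of fun x y => if G.Adj x y then (1 : ℝ) / d else 0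

/-- The absorbing walk: row `m` is replaced by the unit vector at `m`. -/
def absorb (M : Matrix V V ℝ) (m : V) : Matrix V V ℝ :=
  Matrix.of fun x y => if x = m then (if y = m then 1 else 0) else M x y

/-- The interpolated walk `M(s) = (1−s) M + s M'`. -/
def interp (M : Matrix V V ℝ) (m : V) (s : ℝ) : Matrix V V ℝ :=
  (1 - s) • M + s • absorb M m

/-- The lazy random walk `P̂ = (d/(d+ℓ)) P + (ℓ/(d+ℓ)) I`. -/
def lazyP (G : SimpleGraph V) [DecidableRel G.Adj] (d : ℕ) (ℓ : ℝ) : Matrix V V ℝ :=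
  ((d : ℝ) / (d + ℓ)) • Pmat G d + (ℓ / (d + ℓ)) • (1 : Matrix V V ℝ)

/-- The submatrix `Q` of `P` obtained by deleting the row and column of `m`. -/
def Qsub (P : Matrix V V ℝ) (m : V) :
    Matrix {x : V // x ≠ m} {x : V // x ≠ m} ℝ :=
  Matrix.of fun x y => P x.1 y.1

/-- The hitting time `HT(P, {m}) = Σ_{t≥0} (1/N) Σ_{x≠m, y≠m} (Q^t)_{xy}`. -/
def hittingTime (P : Matrix V V ℝ) (m : V) : ℝ :=
  ∑' t : ℕ, (1 / (Fintype.card V : ℝ)) *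
    ∑ x : {x : V // x ≠ m}, ∑ y : {x : V // x ≠ m}, (Qsub P m ^ t) x y

/-- The state `|x⟩ ⊗ |P(s)_x⟩ = Σ_y √(P(s)_{xy}) |x,y⟩`. -/
def psVec (Ps : Matrix V V ℝ) (x : V) : V × V → ℂ :=
  fun p => if p.1 = x then ((Real.sqrt (Ps x p.2) : ℝ) : ℂ) else 0

/-- The projection `Π_A = Σ_x |x, P(s)_x⟩⟨x, P(s)_x|` onto `span{|x⟩ ⊗ |P(s)_x⟩}`. -/
def projA (Ps : Matrix V V ℝ) : Matrix (V × V) (V × V) ℂ :=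
  Matrix.of fun p q => ∑ x, psVec Ps x p * (starRingEnd ℂ) (psVec Ps x q)

/-- The swap of the two tensor factors of `ℂ^V ⊗ ℂ^V`, as a matrix. -/
def swapMat (V : Type*) [Fintype V] [DecidableEq V] : Matrix (V × V) (V × V) ℂ :=
  Matrix.of fun p q => if p.1 = q.2 ∧ p.2 = q.1 then 1 else 0

/-- Szegedy's quantum walk `W = SWAP · (2Π_A − I)` of a walk with matrix `Ps`. -/
def Wmat (Ps : Matrix V V ℝ) : Matrix (V × V) (V × V) ℂ :=
  swapMat V * ((2 : ℂ) • projA Ps - 1)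

/-- The initial state `|init_ip⟩ = (1/√(N−1)) Σ_{x ≠ m} |x⟩ ⊗ |P(s)_x⟩`. -/
def initIp (Ps : Matrix V V ℝ) (m : V) : V × V → ℂ :=
  fun p => if p.1 = m then 0
    else ((1 / Real.sqrt ((Fintype.card V : ℝ) - 1) : ℝ) : ℂ) * ((Real.sqrt (Ps p.1 p.2) : ℝ) : ℂ)

/-- The discriminant matrix, `D_{xy} = √(M_{xy} M_{yx})`. -/
def discr (M : Matrix V V ℝ) : Matrix V V ℝ :=
  Matrix.of fun x y => Real.sqrt (M x y * M y x)

/-- The unit vector `√π̄ = (1/√(N−1)) Σ_{x ≠ m} |x⟩`. -/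
def sqrtPiBar (m : V) : V → ℝ :=
  fun x => if x = m then 0 else 1 / Real.sqrt ((Fintype.card V : ℝ) - 1)

/-- `(θ, φ)` is an orthonormal eigenbasis of the (unitary) matrix `M`, with
eigenvalues `e^{iθ_k}` and eigenvectors `φ_k`. -/
def IsONEigenbasis {ι : Type*} [Fintype ι] [DecidableEq ι] (M : Matrix ι ι ℂ)
    (θ : ι → ℝ) (φ : ι → (ι → ℂ)) : Prop :=
  (∀ k l, cip (φ k) (φ l) = if k = l then 1 else 0) ∧
  (∀ k, M.mulVec (φ k) = Complex.exp ((θ k : ℂ) * Complex.I) • φ k)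

/-- The squared cotangent quantum hitting time
`QHT(U, w)² = Σ_{e^{iθ_k} ≠ 1} |⟨φ_k|w⟩|² cot²(θ_k/2)` computed in the
orthonormal eigenbasis `(θ, φ)`. -/
def QHTsq {ι : Type*} [Fintype ι] (θ : ι → ℝ) (φ : ι → (ι → ℂ)) (w : ι → ℂ) : ℝ :=
  ∑ k, if Complex.exp ((θ k : ℂ) * Complex.I) = 1 then 0
       else Complex.normSq (cip (φ k) w) * (Real.cos (θ k / 2) / Real.sin (θ k / 2)) ^ 2

/-- `(lam, v)` is a real orthonormal eigenbasis of the symmetric matrix `M`. -/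
def IsRealONEigenbasis (M : Matrix V V ℝ) (lam : V → ℝ) (v : V → (V → ℝ)) : Prop :=
  (∀ k l, (∑ x, v k x * v l x) = if k = l then 1 else 0) ∧
  (∀ k, M.mulVec (v k) = lam k • v k)

/-- The interpolated hitting time `HT⁺ = Σ_{λ_k ≠ 1} |⟨λ_k|√π̄⟩|² / (1 − λ_k)`,
computed in the orthonormal eigenbasis `(lam, v)` of the discriminant. -/
def HTplus (lam : V → ℝ) (v : V → (V → ℝ)) (m : V) : ℝ :=
  ∑ k, if lam k = 1 then 0 else (∑ x, v k x * sqrtPiBar m x) ^ 2 / (1 - lam k)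

/-- The map `E : ℂ^V ⊗ ℂ^V → ℂ^V ⊗ ℂ^{d+1}` with `E|x, y_i(x)⟩ = |x, e_i⟩`,
`E|x,x⟩ = |x,↻⟩` for `x ≠ m`, `E|m,m⟩ = −|m,↻⟩`, and `E|x,y⟩ = 0` otherwise. -/
def Emat {G : SimpleGraph V} [DecidableRel G.Adj] {d : ℕ}
    (L : Labeling G d) (m : V) : Matrix (V × Fin (d + 1)) (V × V) ℂ :=
  Matrix.of fun p q =>
    if h : G.Adj q.1 q.2 then
      (if p = (q.1, Fin.castSucc (L.idx q.1 q.2 h)) then 1 else 0)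
    else if q.2 = q.1 then
      (if p = (q.1, Fin.last d) then (if q.1 = m then -1 else 1) else 0)
    else 0

/-- `SWAP` applied to a vector of `ℂ^V ⊗ ℂ^V`. -/
def swapVecC (v : V × V → ℂ) : V × V → ℂ := fun p => v (p.2, p.1)

/-- The unit vector `|x, Ps_x^⊥⟩` orthogonal to `|x, Ps_x⟩` in
`span{|x, Ps_x⟩, SWAP |x, Ps_x⟩}` (Gram–Schmidt phase convention). -/
def perpVec (Ps : Matrix V V ℝ) (x : V) : V × V → ℂ :=
  fun p =>
    (swapVecC (psVec Ps x) - cip (psVec Ps x) (swapVecC (psVec Ps x)) • psVec Ps x) p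
      / ((l2norm (swapVecC (psVec Ps x) - cip (psVec Ps x) (swapVecC (psVec Ps x)) • psVec Ps x) : ℝ) : ℂ)

/-- The isometry `Σ_x (|x, Ps1_x⟩⟨x, Ps2_x| + |x, Ps1_x^⊥⟩⟨x, Ps2_x^⊥|)`;
`R₁ = Rmat P̂(s) P(s)` and `R₂ = Rmat P(s) P(s)`. -/
def Rmat (Ps1 Ps2 : Matrix V V ℝ) : Matrix (V × V) (V × V) ℂ :=
  Matrix.of fun p q => ∑ x, (psVec Ps1 x p * (starRingEnd ℂ) (psVec Ps2 x q)
    + perpVec Ps1 x p * (starRingEnd ℂ) (perpVec Ps2 x q))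

end LQWPaper

namespace LQWPaper


section Embedding

variable {V : Type*} [Fintype V] [DecidableEq V] {G : SimpleGraph V} {d : ℕ}

/-- The arc or self-loop of `V × V` corresponding to a basis state of `V × Fin (d + 1)`. -/
def arc (L : Labeling G d) (p : V × Fin (d + 1)) : V × V :=
  (p.1, if h : p.2 = Fin.last d then p.1 else L.nbr p.1 (p.2.castPred h))

/-- The sign picked up by the self-loop at the marked vertex. -/
def loopSign (d : ℕ) (m : V) (p : V × Fin (d + 1)) : ℝ :=
  if p = (m, Fin.last d) then -1 else 1

@[simp] lemma arc_last (L : Labeling G d) (x : V) : arc L (x, Fin.last d) = (x, x) := by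
  simp [arc]

@[simp] lemma arc_castSucc (L : Labeling G d) (x : V) (i : Fin d) :
    arc L (x, i.castSucc) = (x, (L.nbr x i : V)) := by
  simp [arc, Fin.castSucc_ne_last]

@[simp] lemma loopSign_last (m x : V) :
    loopSign d m (x, Fin.last d) = if x = m then -1 else 1 := by
  simp [loopSign]

@[simp] lemma loopSign_castSucc (m x : V) (i : Fin d) : loopSign d m (x, i.castSucc) = 1 := by
  simp [loopSign, Fin.castSucc_ne_last]

lemma loopSign_mul_self (m : V) (p : V × Fin (d + 1)) :
    loopSign d m p * loopSign d m p = 1 := by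
  unfold loopSign; split_ifs <;> norm_num

@[simp] lemma shiftFun_last (L : Labeling G d) (x : V) :
    shiftFun L (x, Fin.last d) = (x, Fin.last d) := by
  simp [shiftFun]

@[simp] lemma shiftFun_castSucc (L : Labeling G d) (x : V) (i : Fin d) :
    shiftFun L (x, i.castSucc) =
      ((L.nbr x i : V), (L.idx (L.nbr x i) x (L.adj x i).symm).castSucc) := by
  simp [shiftFun, Fin.castSucc_ne_last]

@[simp] lemma Labeling.nbr_idx (L : Labeling G d) (y x : V) (h : G.Adj y x) :
    (L.nbr y (L.idx y x h) : V) = x := by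
  simp [Labeling.idx]

lemma arc_injective (L : Labeling G d) : Function.Injective (arc L) := by
  rintro ⟨x, a⟩ ⟨y, b⟩ h
  obtain rfl : x = y := congrArg Prod.fst h
  induction a using Fin.lastCases with
  | last =>
    induction b using Fin.lastCases with
    | last => rfl
    | cast j => exact absurd (by simpa using h) (L.adj x j).ne
  | cast i =>
    induction b using Fin.lastCases with
    | last => exact absurd (by simpa using h) (L.adj x i).ne'
    | cast j => simpa [Subtype.coe_inj] using h

lemma arc_shiftFun (L : Labeling G d) (p : V × Fin (d + 1)) :
    arc L (shiftFun L p) = (arc L p).swap := by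
  obtain ⟨x, a⟩ := p
  induction a using Fin.lastCases <;> simp

lemma shiftFun_involutive (L : Labeling G d) : Function.Involutive (shiftFun L) := fun p =>
  arc_injective L (by simp [arc_shiftFun])

lemma loopSign_shiftFun (L : Labeling G d) (m : V) (p : V × Fin (d + 1)) :
    loopSign d m (shiftFun L p) = loopSign d m p := by
  obtain ⟨x, a⟩ := p
  induction a using Fin.lastCases <;> simp

lemma Emat_apply [DecidableRel G.Adj] (L : Labeling G d) (m : V) (p : V × Fin (d + 1))
    (q : V × V) : Emat L m p q = if q = arc L p then (loopSign d m p : ℂ) else 0 := by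
  obtain ⟨x, a⟩ := p
  obtain ⟨y, z⟩ := q
  induction a using Fin.lastCases with
  | last =>
    simp only [Emat, Matrix.of_apply, arc_last, loopSign_last]
    by_cases hyz : G.Adj y z
    · have : ¬ (y = x ∧ z = x) := fun h => hyz.ne (h.1.trans h.2.symm)
      simp [hyz, this, (Fin.castSucc_ne_last _).symm]
    · by_cases h : z = y
      · subst h
        by_cases hx : x = z
        · subst hx; by_cases hm : x = m <;> simp [hm]
        · simp [hx, Ne.symm hx]
      · have : ¬ (y = x ∧ z = x) := fun h' => h (h'.2.trans h'.1.symm)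
        simp [hyz, h, this]
  | cast i =>
    simp only [Emat, Matrix.of_apply, arc_castSucc, loopSign_castSucc]
    by_cases hyz : G.Adj y z
    · rw [dif_pos hyz]
      congr 1
      simp only [Prod.mk.injEq, Fin.castSucc_inj, eq_iff_iff]
      constructor
      · rintro ⟨rfl, rfl⟩; simp
      · rintro ⟨rfl, rfl⟩; exact ⟨rfl, ((L.nbr y).symm_apply_apply i).symm⟩
    · have : ¬ (y = x ∧ z = L.nbr x i) := by
        rintro ⟨rfl, rfl⟩; exact hyz (L.adj y i)
      simp [hyz, this, Fin.castSucc_ne_last]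

lemma shiftMat_mul_apply (L : Labeling G d)
    (M : Matrix (V × Fin (d + 1)) (V × Fin (d + 1)) ℂ) (p q : V × Fin (d + 1)) :
    (shiftMat L * M) p q = M (shiftFun L p) q := by
  have h (r) : p = shiftFun L r ↔ r = shiftFun L p := by
    constructor <;> rintro rfl <;> simp [shiftFun_involutive L _]
  simp [Matrix.mul_apply, shiftMat, h]

lemma swapMat_mul_apply (M : Matrix (V × V) (V × V) ℂ) (p q : V × V) :
    (swapMat V * M) p q = M p.swap q := by
  have h (r : V × V) : (p.1 = r.2 ∧ p.2 = r.1) ↔ r = p.swap := by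
    rw [Prod.ext_iff]; simp only [Prod.fst_swap, Prod.snd_swap]; tauto
  simp [Matrix.mul_apply, swapMat, h]

lemma Emat_conj_apply [DecidableRel G.Adj] (L : Labeling G d) (m : V)
    (M : Matrix (V × V) (V × V) ℂ) (p q : V × Fin (d + 1)) :
    (Emat L m * M * (Emat L m).conjTranspose) p q =
      loopSign d m p * M (arc L p) (arc L q) * loopSign d m q := by
  simp [Matrix.mul_apply, Emat_apply, apply_ite (starRingEnd ℂ)]

/-- The real coefficient of `E|x, Ps_x⟩` at the basis state `p` with first component `x`. -/
def arcAmp (L : Labeling G d) (m : V) (Ps : Matrix V V ℝ) (p : V × Fin (d + 1)) : ℝ :=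
  loopSign d m p * √(Ps p.1 (arc L p).2)

lemma projA_apply (Ps : Matrix V V ℝ) (p q : V × V) :
    projA Ps p q = if p.1 = q.1 then (√(Ps p.1 p.2) : ℂ) * √(Ps q.1 q.2) else 0 := by
  simp only [projA, psVec, Matrix.of_apply, apply_ite (starRingEnd ℂ), Complex.conj_ofReal,
    map_zero]
  split_ifs with h
  · rw [Finset.sum_eq_single p.1] <;> simp +contextual [h, eq_comm]
  · refine Finset.sum_eq_zero fun x _ => ?_
    by_cases hx : p.1 = x
    · subst hx; simp [Ne.symm h]
    · simp [hx]

lemma Emat_Wmat_apply [DecidableRel G.Adj] (L : Labeling G d) (m : V) (Ps : Matrix V V ℝ)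
    (p q : V × Fin (d + 1)) :
    (Emat L m * Wmat Ps * (Emat L m).conjTranspose) p q =
      2 * (if (shiftFun L p).1 = q.1 then
        (arcAmp L m Ps (shiftFun L p) : ℂ) * arcAmp L m Ps q else 0)
      - if shiftFun L p = q then 1 else 0 := by
  rw [Emat_conj_apply, Wmat, swapMat_mul_apply, ← arc_shiftFun, ← loopSign_shiftFun L]
  generalize shiftFun L p = p
  simp only [Matrix.sub_apply, Matrix.smul_apply, projA_apply, Matrix.one_apply,
    (arc_injective L).eq_iff, arcAmp, smul_eq_mul]
  have hs : (loopSign d m q : ℂ) * loopSign d m q = 1 := mod_cast loopSign_mul_self m q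
  by_cases hpq : p = q
  · subst hpq
    simp [arc]
    linear_combination -hs
  · by_cases h : p.1 = q.1
    · simp [hpq, h, arc]
      ring
    · simp [hpq, h, arc]

end Embedding

section Coin

variable {V : Type*} [Fintype V] [DecidableEq V]

/-- The self-loop basis vector of the coin space. -/
def loopVec (d : ℕ) : Fin (d + 1) → ℂ := fun a => if a = Fin.last d then 1 else 0

lemma coinLift_mulVec (d : ℕ) (ℓ : ℝ) (m : V) (t : Fin (d + 1) → ℂ) (p : V × Fin (d + 1)) :
    ∑ r, coinLift d ℓ p r * (if r.1 = m then t r.2 else 0) =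
      if p.1 = m then
        2 * coinVec d ℓ p.2 * (∑ b, (starRingEnd ℂ) (coinVec d ℓ b) * t b) - t p.2 else 0 := by
  rw [Fintype.sum_prod_type, Finset.sum_eq_single p.1]
  · split_ifs with h
    · simp [coinLift, coinMat, h, Matrix.one_apply, sub_mul, Finset.sum_sub_distrib,
        Finset.mul_sum, mul_assoc]
    · simp
  · intro x _ hx
    simp [coinLift, hx.symm]
  · simp

lemma oracleHat_apply (d : ℕ) (m : V) (p q : V × Fin (d + 1)) :
    oracleHat d m p q = (if p = q then 1 else 0) - 2 *
      ((if p.1 = m then loopVec d p.2 else 0) * (if q.1 = m then loopVec d q.2 else 0)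
      + (if p.1 = m then plusVec d p.2 else 0) * (if q.1 = m then plusVec d q.2 else 0)) := by
  have hp : (starRingEnd ℂ) (plusVec d q.2) = plusVec d q.2 := by
    simp only [plusVec]; split_ifs <;> simp
  simp only [oracleHat, Matrix.sub_apply, Matrix.smul_apply, Matrix.one_apply, Matrix.of_apply,
    smul_eq_mul, hp, loopVec, Prod.ext_iff]
  by_cases h1 : p.1 = m <;> by_cases h2 : q.1 = m <;> by_cases h3 : p.2 = Fin.last d <;>
    by_cases h4 : q.2 = Fin.last d <;> simp [h1, h2, h3, h4]

lemma coinLift_mul_oracleHat_apply {d : ℕ} {ℓ a b : ℝ} (m : V) (hd : 1 ≤ d)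
    (hc : ∀ i, coinVec d ℓ i = a * plusVec d i + b * loopVec d i)
    (p q : V × Fin (d + 1)) :
    (coinLift d ℓ * oracleHat d m :
        Matrix (V × Fin (d + 1)) (V × Fin (d + 1)) ℂ) p q =
      (if p.1 = q.1 then 2 * coinVec d ℓ p.2 * coinVec d ℓ q.2 else 0)
      - (if p = q then 1 else 0)
      - 2 * (if p.1 = m then
        (2 * coinVec d ℓ p.2 * b - loopVec d p.2) * (if q.1 = m then loopVec d q.2 else 0)
        + (2 * coinVec d ℓ p.2 * a - plusVec d p.2) * (if q.1 = m then plusVec d q.2 else 0)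
        else 0) := by
  have hconj (i) : (starRingEnd ℂ) (coinVec d ℓ i) = coinVec d ℓ i := by
    simp only [coinVec]; split_ifs <;> simp
  have hd0 : (√(d : ℝ) : ℂ) * √(d : ℝ) = d := by
    rw [← Complex.ofReal_mul, Real.mul_self_sqrt (by positivity)]; simp
  have hdn : (d : ℂ) ≠ 0 := by exact_mod_cast (by omega : d ≠ 0)
  have hloop : ∑ i, (starRingEnd ℂ) (coinVec d ℓ i) * loopVec d i = b := by
    simp [hc, loopVec, plusVec]
  have hplus : ∑ i, (starRingEnd ℂ) (coinVec d ℓ i) * plusVec d i = a := by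
    have h0 : (√(d : ℝ) : ℂ) ≠ 0 := fun h => hdn (by rw [← hd0, h, zero_mul])
    simp only [hc, loopVec, plusVec, Fin.sum_univ_castSucc]
    simp [Fin.castSucc_ne_last]
    field_simp
    rw [pow_two, hd0, mul_comm]
  have expand : (coinLift d ℓ * oracleHat d m :
        Matrix (V × Fin (d + 1)) (V × Fin (d + 1)) ℂ) p q = coinLift d ℓ p q - 2 *
      ((∑ r, coinLift d ℓ p r * (if r.1 = m then loopVec d r.2 else 0))
          * (if q.1 = m then loopVec d q.2 else 0)
        + (∑ r, coinLift d ℓ p r * (if r.1 = m then plusVec d r.2 else 0))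
          * (if q.1 = m then plusVec d q.2 else 0)) := by
    simp only [Matrix.mul_apply, oracleHat_apply, mul_sub, Finset.sum_sub_distrib, mul_add,
      Finset.sum_add_distrib, Finset.sum_mul, Finset.mul_sum]
    congr 1
    · simp
    · congr 1 <;> exact Finset.sum_congr rfl fun _ _ => by ring
  rw [expand, coinLift_mulVec, coinLift_mulVec, hloop, hplus]
  congr 1
  · simp only [coinLift, coinMat, Matrix.of_apply, Matrix.sub_apply, Matrix.smul_apply,
      Matrix.one_apply, smul_eq_mul, hconj, Prod.ext_iff]
    by_cases h : p.1 = q.1 <;> simp [h, mul_assoc]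
  · by_cases h : p.1 = m <;> simp [h]

end Coin

theorem statement_7 {V : Type*} [Fintype V] [DecidableEq V]
    (G : SimpleGraph V) [DecidableRel G.Adj] (d : ℕ) (L : Labeling G d) (m : V)
    (hd : 1 ≤ d) (hN : 3 ≤ Fintype.card V) (hconn : G.Connected)
    (hreg : G.IsRegularOfDegree d)
    (ℓ s : ℝ) (hℓ : ℓ = d / (Fintype.card V : ℝ)) (hs : s = 1 - 1 / (Fintype.card V : ℝ)) :
    UlazyHat L m ℓ = Emat L m * Wmat (interp (lazyP G d ℓ) m s) * (Emat L m).conjTranspose := by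
  have hN0 : (0 : ℝ) < Fintype.card V := by exact_mod_cast (by omega : 0 < Fintype.card V)
  have hd0 : (0 : ℝ) < d := by exact_mod_cast hd
  generalize (Fintype.card V : ℝ) = N at *
  have hdℓ : d + ℓ = d / (N / (N + 1)) := by rw [hℓ]; field_simp
  have hrd : (d : ℝ) / (d + ℓ) = N / (N + 1) := by rw [hdℓ]; field_simp
  have hrℓ : ℓ / (d + ℓ) = 1 / (N + 1) := by rw [hdℓ, hℓ]; field_simp
  set a : ℝ := √(N / (N + 1)) with ha
  set b : ℝ := √(1 / (N + 1)) with hb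
  have hab : a * a + b * b = 1 := by
    rw [Real.mul_self_sqrt (by positivity), Real.mul_self_sqrt (by positivity)]; field_simp
  have hc (i) : coinVec d ℓ i = a * plusVec d i + b * loopVec d i := by
    simp only [coinVec, plusVec, loopVec]
    split_ifs
    · rw [← Real.sqrt_div' _ (by rw [hdℓ]; positivity), hrℓ]; simp [hb]
    · rw [hdℓ, Real.sqrt_div hd0.le, one_div_div]; simp [ha, div_eq_mul_inv]
  have hamp (x i) (hx : x ≠ m) :
      (arcAmp L m (interp (lazyP G d ℓ) m s) (x, i) : ℂ) = coinVec d ℓ i := by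
    rw [hc]
    induction i using Fin.lastCases with
    | last =>
      have : (1 - s) * (1 / (N + 1)) + s * (1 / (N + 1)) = 1 / (N + 1) := by ring
      simp [-one_div, arcAmp, interp, absorb, lazyP, hx, Pmat, hrℓ, plusVec, loopVec, this, ← hb]
    | cast i =>
      have h := L.adj x i
      have : (1 - s) * (N / (N + 1) * (1 / d)) + s * (N / (N + 1) * (1 / d)) = N / (N + 1) / d := by
        ring
      simp only [arcAmp, interp, absorb, lazyP, hrd, Pmat, plusVec, loopVec, Matrix.add_apply,
        Matrix.smul_apply, Matrix.of_apply, Matrix.one_apply, arc_castSucc, h, h.ne, hx,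
        loopSign_castSucc, if_true, if_false, smul_eq_mul, mul_zero, add_zero, this,
        Fin.castSucc_ne_last, Real.sqrt_div' _ hd0.le, ← ha]
      simp [div_eq_mul_inv]
  have hampm (i) : (arcAmp L m (interp (lazyP G d ℓ) m s) (m, i) : ℂ) =
      b * plusVec d i - a * loopVec d i := by
    induction i using Fin.lastCases with
    | last =>
      have : (1 - s) * (1 / (N + 1)) + s = N / (N + 1) := by rw [hs]; field_simp; ring
      simp [arcAmp, interp, absorb, lazyP, Pmat, hrℓ, plusVec, loopVec, ha, ← this]
    | cast i =>
      have h := L.adj m i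
      have : (1 - s) * (N / (N + 1) * (1 / d)) = 1 / (N + 1) / d := by rw [hs]; field_simp; ring
      simp only [arcAmp, interp, absorb, lazyP, hrd, Pmat, plusVec, loopVec, Matrix.add_apply,
        Matrix.smul_apply, Matrix.of_apply, Matrix.one_apply, arc_castSucc, h, h.ne, h.ne',
        loopSign_castSucc, if_true, if_false, smul_eq_mul, mul_zero, add_zero, this,
        Fin.castSucc_ne_last, Real.sqrt_div' _ hd0.le, ← hb]
      simp [div_eq_mul_inv]
  have habc : (a : ℂ) * a + b * b = 1 := mod_cast hab
  ext p q
  rw [UlazyHat, Matrix.mul_assoc, shiftMat_mul_apply, Emat_Wmat_apply,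
    coinLift_mul_oracleHat_apply m hd hc]
  generalize shiftFun L p = p
  obtain ⟨x, i⟩ := p
  obtain ⟨y, j⟩ := q
  by_cases hxy : x = y
  · subst hxy
    by_cases hx : x = m
    · subst hx
      simp only [if_true, hampm, hc]
      linear_combination (-2 * (plusVec d i * plusVec d j + loopVec d i * loopVec d j)) * habc
    · simp only [if_true, hx, if_false, hamp x _ hx]
      ring
  · have hxm : x = m → y ≠ m := fun h h' => hxy (h.trans h'.symm)
    by_cases hx : x = m
    · have hy := hxm hx
      subst hx
      simp [hxy, hy]
    · simp [hxy, hx]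

end LQWPaper
end
end

section
/- With ℓ = d/N and s = 1 − 1/N, the cotangent quantum hitting times of Szegedy's quantum walks of the interpolated lazy walk and of the interpolated walk satisfy the exact identity QHT(W(P̂(s)), |init_ip̂⟩)² = ((N+1)/N)·QHT(W(s), |init_ip⟩)² + 1/(2N−1). -/
open scoped BigOperators ComplexConjugate
open Complex

set_option linter.unusedSectionVars false

noncomputable section

namespace LQWPaper

section Walk

variable {V : Type*} [Fintype V] [DecidableEq V]

/-- The isometry `|x⟩ ↦ |x⟩ ⊗ |Ps_x⟩` applied to a real vector. -/
def liftVec (Ps : Matrix V V ℝ) (f : V → ℝ) : V × V → ℂ :=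
  fun p => ((f p.1 * Real.sqrt (Ps p.1 p.2) : ℝ) : ℂ)

lemma initIp_eq_liftVec (Ps : Matrix V V ℝ) (m : V) :
    initIp Ps m = liftVec Ps (sqrtPiBar m) := by
  ext p
  simp only [initIp, liftVec, sqrtPiBar]
  split_ifs <;> simp

lemma swapMat_mulVec (v : V × V → ℂ) : (swapMat V).mulVec v = swapVecC v := by
  ext p
  have h : ∀ q : V × V, (p.1 = q.2 ∧ p.2 = q.1) ↔ (p.2, p.1) = q := fun q => by
    rw [Prod.ext_iff]; tauto
  simp [Matrix.mulVec, dotProduct, swapMat, swapVecC, h]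

lemma projA_mulVec (Ps : Matrix V V ℝ) (v : V × V → ℂ) (p : V × V) :
    (projA Ps).mulVec v p =
      (Real.sqrt (Ps p.1 p.2) : ℂ) * ∑ y, (Real.sqrt (Ps p.1 y) : ℂ) * v (p.1, y) := by
  simp [Matrix.mulVec, dotProduct, projA, psVec, Fintype.sum_prod_type, apply_ite,
    Finset.mul_sum, mul_assoc, Finset.sum_ite_irrel]

lemma sum_sqrt_mul_self {Ps : Matrix V V ℝ} (h0 : ∀ x y, 0 ≤ Ps x y)
    (h1 : ∀ x, ∑ y, Ps x y = 1) (x : V) :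
    ∑ y, Real.sqrt (Ps x y) * Real.sqrt (Ps x y) = 1 := by
  simp only [Real.mul_self_sqrt (h0 x _), h1]

lemma projA_mulVec_liftVec {Ps : Matrix V V ℝ} (h0 : ∀ x y, 0 ≤ Ps x y)
    (h1 : ∀ x, ∑ y, Ps x y = 1) (g : V → ℝ) :
    (projA Ps).mulVec (liftVec Ps g) = liftVec Ps g := by
  ext p
  rw [projA_mulVec]
  simp only [liftVec]
  norm_cast
  have : ∑ y, Real.sqrt (Ps p.1 y) * (g p.1 * Real.sqrt (Ps p.1 y)) = g p.1 := by
    simp only [mul_left_comm _ (g p.1), ← Finset.mul_sum, sum_sqrt_mul_self h0 h1, mul_one]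
  rw [this, mul_comm]

lemma projA_mulVec_swap_liftVec {Ps : Matrix V V ℝ} (h0 : ∀ x y, 0 ≤ Ps x y) (g : V → ℝ) :
    (projA Ps).mulVec (swapVecC (liftVec Ps g)) = liftVec Ps ((discr Ps).mulVec g) := by
  ext p
  rw [projA_mulVec]
  simp only [liftVec, swapVecC, Matrix.mulVec, dotProduct, discr, Matrix.of_apply]
  norm_cast
  rw [mul_comm]
  refine congrArg (fun t : ℝ => t * Real.sqrt (Ps p.1 p.2)) ?_
  refine Finset.sum_congr rfl fun y _ => ?_
  rw [Real.sqrt_mul (h0 _ _)]; ring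

lemma Wmat_mulVec_liftVec {Ps : Matrix V V ℝ} (h0 : ∀ x y, 0 ≤ Ps x y)
    (h1 : ∀ x, ∑ y, Ps x y = 1) (g : V → ℝ) :
    (Wmat Ps).mulVec (liftVec Ps g) = swapVecC (liftVec Ps g) := by
  rw [Wmat, ← Matrix.mulVec_mulVec, Matrix.sub_mulVec, Matrix.smul_mulVec,
    projA_mulVec_liftVec h0 h1, Matrix.one_mulVec, two_smul, add_sub_cancel_right, swapMat_mulVec]

lemma Wmat_mulVec_swap_liftVec {Ps : Matrix V V ℝ} (h0 : ∀ x y, 0 ≤ Ps x y) (g : V → ℝ) :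
    (Wmat Ps).mulVec (swapVecC (liftVec Ps g)) =
      (2 : ℂ) • swapVecC (liftVec Ps ((discr Ps).mulVec g)) - liftVec Ps g := by
  rw [Wmat, ← Matrix.mulVec_mulVec, Matrix.sub_mulVec, Matrix.smul_mulVec,
    projA_mulVec_swap_liftVec h0, Matrix.one_mulVec, swapMat_mulVec]
  rfl

lemma sum_normSq_liftVec {Ps : Matrix V V ℝ} (h0 : ∀ x y, 0 ≤ Ps x y)
    (h1 : ∀ x, ∑ y, Ps x y = 1) (g : V → ℝ) :
    ∑ p, Complex.normSq (liftVec Ps g p) = ∑ x, g x ^ 2 := by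
  rw [Fintype.sum_prod_type]
  refine Finset.sum_congr rfl fun x _ => ?_
  rw [← mul_one (g x ^ 2), ← sum_sqrt_mul_self h0 h1 x, Finset.mul_sum]
  refine Finset.sum_congr rfl fun y _ => ?_
  simp only [liftVec, Complex.normSq_ofReal]
  ring

end Walk

section Eigenbasis

variable {ι : Type*} [Fintype ι] [DecidableEq ι] {M : Matrix ι ι ℂ} {θ : ι → ℝ} {φ : ι → (ι → ℂ)}

lemma cip_eq_conjTranspose_mulVec (φ : ι → (ι → ℂ)) (u : ι → ℂ) (k : ι) :
    cip (φ k) u = ((Matrix.of fun i k => φ k i).conjTranspose.mulVec u) k := by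
  simp [cip, Matrix.mulVec, dotProduct, Matrix.conjTranspose_apply]

lemma IsONEigenbasis.conjTranspose_mul_self (h : IsONEigenbasis M θ φ) :
    (Matrix.of fun i k => φ k i).conjTranspose * (Matrix.of fun i k => φ k i) = 1 := by
  ext k l
  rw [Matrix.one_apply, ← h.1 k l]
  simp [cip, Matrix.mul_apply, Matrix.conjTranspose_apply]

lemma IsONEigenbasis.cip_mulVec (h : IsONEigenbasis M θ φ) (u : ι → ℂ) (k : ι) :
    cip (φ k) (M.mulVec u) = Complex.exp ((θ k : ℂ) * Complex.I) * cip (φ k) u := by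
  have h1 := h.conjTranspose_mul_self
  have h2 := mul_eq_one_comm.mp h1
  set Φ : Matrix ι ι ℂ := Matrix.of fun i k => φ k i with hΦ
  have h3 : M * Φ = Φ * Matrix.diagonal fun k => Complex.exp ((θ k : ℂ) * Complex.I) := by
    ext i k
    rw [Matrix.mul_diagonal]
    have := congrFun (h.2 k) i
    simp only [Matrix.mulVec, dotProduct, Pi.smul_apply, smul_eq_mul] at this
    rw [Matrix.mul_apply, mul_comm]
    exact this
  have h4 : Φ.conjTranspose * M =
      (Matrix.diagonal fun k => Complex.exp ((θ k : ℂ) * Complex.I)) * Φ.conjTranspose := by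
    calc Φ.conjTranspose * M = Φ.conjTranspose * (M * Φ) * Φ.conjTranspose := by
          rw [Matrix.mul_assoc, Matrix.mul_assoc, h2, Matrix.mul_one]
      _ = _ := by rw [h3, ← Matrix.mul_assoc, h1, Matrix.one_mul]
  rw [cip_eq_conjTranspose_mulVec, cip_eq_conjTranspose_mulVec, ← hΦ, Matrix.mulVec_mulVec, h4,
    ← Matrix.mulVec_mulVec, Matrix.mulVec_diagonal]

lemma IsONEigenbasis.sum_normSq_cip (h : IsONEigenbasis M θ φ) (u : ι → ℂ) :
    ∑ k, Complex.normSq (cip (φ k) u) = ∑ i, Complex.normSq (u i) := by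
  have h2 := mul_eq_one_comm.mp h.conjTranspose_mul_self
  have key : ∀ v : ι → ℂ, ((∑ i, Complex.normSq (v i) : ℝ) : ℂ) = star v ⬝ᵥ v := fun v => by
    simp [dotProduct, Complex.normSq_eq_conj_mul_self]
  have : ((∑ k, Complex.normSq (cip (φ k) u) : ℝ) : ℂ) = (∑ i, Complex.normSq (u i) : ℝ) := by
    simp only [cip_eq_conjTranspose_mulVec]
    rw [key, key, Matrix.star_mulVec, Matrix.conjTranspose_conjTranspose,
      ← Matrix.dotProduct_mulVec, Matrix.mulVec_mulVec, h2, Matrix.one_mulVec]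
  exact_mod_cast this

end Eigenbasis

section Cotangent

variable {V : Type*} [Fintype V] [DecidableEq V]

lemma cip_add_right {ι : Type*} [Fintype ι] (v u w : ι → ℂ) :
    cip v (u + w) = cip v u + cip v w := by
  simp [cip, mul_add, Finset.sum_add_distrib]

lemma cip_sub_right {ι : Type*} [Fintype ι] (v u w : ι → ℂ) :
    cip v (u - w) = cip v u - cip v w := by
  simp [cip, mul_sub, Finset.sum_sub_distrib]

lemma cip_smul_right {ι : Type*} [Fintype ι] (v u : ι → ℂ) (c : ℂ) :
    cip v (c • u) = c * cip v u := by
  simp [cip, Finset.mul_sum, mul_left_comm]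

lemma cip_liftVec_discr {Ps : Matrix V V ℝ} (h0 : ∀ x y, 0 ≤ Ps x y)
    (h1 : ∀ x, ∑ y, Ps x y = 1) {θ : V × V → ℝ} {φ : V × V → (V × V → ℂ)}
    (hφ : IsONEigenbasis (Wmat Ps) θ φ) (g : V → ℝ) (k : V × V) :
    cip (φ k) (liftVec Ps ((discr Ps).mulVec g)) =
      (Real.cos (θ k) : ℂ) * cip (φ k) (liftVec Ps g) := by
  have swap_eq : ∀ g, cip (φ k) (swapVecC (liftVec Ps g)) =
      Complex.exp ((θ k : ℂ) * Complex.I) * cip (φ k) (liftVec Ps g) := fun g => by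
    rw [← Wmat_mulVec_liftVec h0 h1, hφ.cip_mulVec]
  have h := hφ.cip_mulVec (swapVecC (liftVec Ps g)) k
  rw [Wmat_mulVec_swap_liftVec h0, cip_sub_right, cip_smul_right, swap_eq, swap_eq] at h
  have hne := Complex.exp_ne_zero ((θ k : ℂ) * Complex.I)
  have hcos : Complex.exp ((θ k : ℂ) * Complex.I) ^ 2 + 1 =
      2 * Complex.exp ((θ k : ℂ) * Complex.I) * (Real.cos (θ k) : ℂ) := by
    rw [Complex.exp_mul_I, Complex.ofReal_cos]
    linear_combination (Complex.sin (θ k)) ^ 2 * Complex.I_sq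
      - Complex.sin_sq_add_cos_sq (θ k : ℂ)
  refine mul_left_cancel₀ (mul_ne_zero two_ne_zero hne) ?_
  linear_combination h + cip (φ k) (liftVec Ps g) * hcos

lemma exp_mul_I_eq_one_iff_cos (t : ℝ) :
    Complex.exp ((t : ℂ) * Complex.I) = 1 ↔ Real.cos t = 1 := by
  rw [Complex.ext_iff, Complex.exp_ofReal_mul_I_re, Complex.exp_ofReal_mul_I_im]
  simp only [Complex.one_re, Complex.one_im]
  refine ⟨fun h => h.1, fun h => ⟨h, ?_⟩⟩
  have := Real.sin_sq_add_cos_sq t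
  rw [h] at this
  exact pow_eq_zero_iff two_ne_zero |>.mp (by linarith)

/-- The cotangent quantum hitting time from a solution `k` of `(I − D) k = r`, where the initial
state is the lift of `f₀ + r` with `f₀` fixed by the discriminant `D`. -/
lemma QHTsq_liftVec {Ps : Matrix V V ℝ} (h0 : ∀ x y, 0 ≤ Ps x y)
    (h1 : ∀ x, ∑ y, Ps x y = 1) {θ : V × V → ℝ} {φ : V × V → (V × V → ℂ)}
    (hφ : IsONEigenbasis (Wmat Ps) θ φ) {f₀ r k : V → ℝ}
    (hf₀ : (discr Ps).mulVec f₀ = f₀) (hk : k - (discr Ps).mulVec k = r) :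
    QHTsq θ φ (liftVec Ps (f₀ + r)) = 2 * ∑ x, k x * r x - ∑ x, r x ^ 2 := by
  have hterm : ∀ j, (if Complex.exp ((θ j : ℂ) * Complex.I) = 1 then 0
       else Complex.normSq (cip (φ j) (liftVec Ps (f₀ + r)))
        * (Real.cos (θ j / 2) / Real.sin (θ j / 2)) ^ 2) =
      Complex.normSq (cip (φ j) (liftVec Ps k)) -
        Complex.normSq (cip (φ j) (liftVec Ps ((discr Ps).mulVec k))) := by
    intro j
    rw [cip_liftVec_discr h0 h1 hφ, Complex.normSq_mul, Complex.normSq_ofReal]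
    split_ifs with hc <;> rw [exp_mul_I_eq_one_iff_cos] at hc
    · rw [hc]; ring
    · have hz := cip_liftVec_discr h0 h1 hφ f₀ j
      rw [hf₀] at hz
      have hz0 : cip (φ j) (liftVec Ps f₀) = 0 := by
        have hc' : (1 : ℂ) - (Real.cos (θ j) : ℂ) ≠ 0 := by
          rw [sub_ne_zero]; exact_mod_cast Ne.symm hc
        refine (mul_eq_zero.mp ?_).resolve_left hc'
        linear_combination hz
      have hsplit : liftVec Ps (f₀ + r) =
          liftVec Ps f₀ + (liftVec Ps k - liftVec Ps ((discr Ps).mulVec k)) := by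
        ext p
        simp only [← hk, liftVec, Pi.add_apply, Pi.sub_apply]
        push_cast; ring
      have hval : cip (φ j) (liftVec Ps (f₀ + r)) =
          ((1 - Real.cos (θ j) : ℝ) : ℂ) * cip (φ j) (liftVec Ps k) := by
        rw [hsplit, cip_add_right, cip_sub_right, hz0, cip_liftVec_discr h0 h1 hφ]
        push_cast; ring
      rw [hval, Complex.normSq_mul, Complex.normSq_ofReal]
      have hcos : Real.cos (θ j) = 1 - 2 * Real.sin (θ j / 2) ^ 2 := by
        rw [show θ j = 2 * (θ j / 2) by ring, Real.cos_two_mul, Real.cos_sq']; ring_nf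
      have hs : Real.sin (θ j / 2) ≠ 0 := fun h => hc (by rw [hcos, h]; ring)
      rw [hcos]
      field_simp
      rw [Real.cos_sq']
      ring
  rw [QHTsq, Finset.sum_congr rfl fun j _ => hterm j, Finset.sum_sub_distrib,
    hφ.sum_normSq_cip, hφ.sum_normSq_cip, sum_normSq_liftVec h0 h1, sum_normSq_liftVec h0 h1,
    Finset.mul_sum, ← Finset.sum_sub_distrib, ← Finset.sum_sub_distrib]
  refine Finset.sum_congr rfl fun x _ => ?_
  rw [← hk, Pi.sub_apply]
  ring

end Cotangent

section PerronFrobenius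

variable {V : Type*} [Fintype V] [DecidableEq V]

/-- A fixed vector of a symmetric nonnegative matrix supporting a connected graph is a multiple
of the positive fixed vector. -/
lemma exists_eq_smul_of_mulVec_eq {G : SimpleGraph V} (hconn : G.Connected) {D : Matrix V V ℝ}
    (hsymm : ∀ x y, D x y = D y x) (hnn : ∀ x y, 0 ≤ D x y) (hadj : ∀ x y, G.Adj x y → 0 < D x y)
    {g : V → ℝ} (hg : ∀ x, 0 < g x) (hDg : D.mulVec g = g) {v : V → ℝ} (hv : D.mulVec v = v) :
    ∃ c : ℝ, v = c • g := by
  set q : V → ℝ := fun x => v x / g x with hq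
  have hvq : ∀ x, v x = q x * g x := fun x => (div_mul_cancel₀ _ (hg x).ne').symm
  have hg' : ∀ x, ∑ y, D x y * g y = g x := fun x => congrFun hDg x
  have hv' : ∀ x, ∑ y, D x y * (q y * g y) = q x * g x := fun x => by
    simpa only [Matrix.mulVec, dotProduct, hvq] using congrFun hv x
  have hdir : ∑ x, ∑ y, g x * D x y * g y * (q x - q y) ^ 2 = 0 := by
    have e1 : ∑ x, ∑ y, g x * D x y * g y * q x ^ 2 = ∑ x, (q x * g x) ^ 2 := by
      refine Finset.sum_congr rfl fun x _ => ?_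
      calc _ = g x * q x ^ 2 * ∑ y, D x y * g y := by
            rw [Finset.mul_sum]; exact Finset.sum_congr rfl fun y _ => by ring
        _ = _ := by rw [hg']; ring
    have e2 : ∑ x, ∑ y, g x * D x y * g y * q y ^ 2 = ∑ x, (q x * g x) ^ 2 := by
      rw [← e1, Finset.sum_comm]
      refine Finset.sum_congr rfl fun x _ => Finset.sum_congr rfl fun y _ => ?_
      rw [hsymm]; ring
    have e3 : ∑ x, ∑ y, g x * D x y * g y * (q x * q y) = ∑ x, (q x * g x) ^ 2 := by
      refine Finset.sum_congr rfl fun x _ => ?_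
      calc _ = g x * q x * ∑ y, D x y * (q y * g y) := by
            rw [Finset.mul_sum]; exact Finset.sum_congr rfl fun y _ => by ring
        _ = _ := by rw [hv']; ring
    calc _ = ∑ x, ∑ y, g x * D x y * g y * q x ^ 2 + ∑ x, ∑ y, g x * D x y * g y * q y ^ 2
          - 2 * ∑ x, ∑ y, g x * D x y * g y * (q x * q y) := by
          simp only [Finset.mul_sum, ← Finset.sum_add_distrib, ← Finset.sum_sub_distrib]
          exact Finset.sum_congr rfl fun x _ => Finset.sum_congr rfl fun y _ => by ring
      _ = 0 := by rw [e1, e2, e3]; ring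
  have hnonneg : ∀ x y, 0 ≤ g x * D x y * g y * (q x - q y) ^ 2 := fun x y =>
    mul_nonneg (mul_nonneg (mul_nonneg (hg x).le (hnn x y)) (hg y).le) (sq_nonneg _)
  have hstep : ∀ x y, G.Adj x y → q x = q y := by
    intro x y hxy
    have hx := (Finset.sum_eq_zero_iff_of_nonneg fun x _ =>
      Finset.sum_nonneg fun y _ => hnonneg x y).mp hdir x (Finset.mem_univ _)
    have hy := (Finset.sum_eq_zero_iff_of_nonneg fun y _ => hnonneg x y).mp hx y
      (Finset.mem_univ _)
    have hpos : 0 < g x * D x y * g y := mul_pos (mul_pos (hg x) (hadj x y hxy)) (hg y)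
    have := (mul_eq_zero.mp hy).resolve_left hpos.ne'
    exact sub_eq_zero.mp (pow_eq_zero_iff two_ne_zero |>.mp this)
  have hwalk : ∀ {x y : V}, G.Walk x y → q x = q y := by
    intro x y p
    induction p with
    | nil => rfl
    | cons h _ ih => exact (hstep _ _ h).trans ih
  obtain ⟨x₀⟩ := hconn.nonempty
  refine ⟨q x₀, funext fun x => ?_⟩
  obtain ⟨p⟩ := hconn.preconnected x₀ x
  rw [Pi.smul_apply, smul_eq_mul, hwalk p, hvq]

lemma exists_sub_mulVec_add_eq {G : SimpleGraph V} (hconn : G.Connected) {D : Matrix V V ℝ}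
    (hsymm : ∀ x y, D x y = D y x) (hnn : ∀ x y, 0 ≤ D x y) (hadj : ∀ x y, G.Adj x y → 0 < D x y)
    {g : V → ℝ} (hg : ∀ x, 0 < g x) (hDg : D.mulVec g = g) (f : V → ℝ) :
    ∃ k : V → ℝ, (g ⬝ᵥ f = (g ⬝ᵥ k) * (g ⬝ᵥ g)) ∧ (g ⬝ᵥ k) • g + (k - D.mulVec k) = f := by
  obtain ⟨x₀⟩ := hconn.nonempty
  have hgg : 0 < g ⬝ᵥ g := Finset.sum_pos (fun x _ => mul_pos (hg x) (hg x)) ⟨x₀, Finset.mem_univ _⟩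
  have hperp : ∀ k, g ⬝ᵥ (k - D.mulVec k) = 0 := fun k => by
    have hT : D.transpose = D := by ext x y; exact hsymm y x
    rw [dotProduct_sub, Matrix.dotProduct_mulVec, ← Matrix.mulVec_transpose, hT, hDg, sub_self]
  let T : (V → ℝ) →ₗ[ℝ] (V → ℝ) :=
    { toFun := fun k => (g ⬝ᵥ k) • g + (k - D.mulVec k)
      map_add' := fun a b => by
        rw [dotProduct_add, Matrix.mulVec_add, add_smul]; abel
      map_smul' := fun c a => by
        rw [dotProduct_smul, Matrix.mulVec_smul, RingHom.id_apply, smul_add, smul_sub, smul_smul,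
          smul_eq_mul] }
  have hT : ∀ k, g ⬝ᵥ T k = (g ⬝ᵥ k) * (g ⬝ᵥ g) := fun k => by
    change g ⬝ᵥ ((g ⬝ᵥ k) • g + (k - D.mulVec k)) = _
    rw [dotProduct_add, hperp, dotProduct_smul, add_zero, smul_eq_mul]
  have hinj : Function.Injective T := by
    rw [← LinearMap.ker_eq_bot, LinearMap.ker_eq_bot']
    intro k hk
    have hgk : g ⬝ᵥ k = 0 := by
      have := hT k
      rw [hk, dotProduct_zero] at this
      exact (mul_eq_zero.mp this.symm).resolve_right hgg.ne'
    have hfix : k - D.mulVec k = 0 := by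
      have : (g ⬝ᵥ k) • g + (k - D.mulVec k) = 0 := hk
      rwa [hgk, zero_smul, zero_add] at this
    obtain ⟨c, rfl⟩ := exists_eq_smul_of_mulVec_eq hconn hsymm hnn hadj hg hDg
      (sub_eq_zero.mp hfix).symm
    rw [dotProduct_smul, smul_eq_mul] at hgk
    rw [(mul_eq_zero.mp hgk).resolve_right hgg.ne', zero_smul]
  obtain ⟨k, hk⟩ := LinearMap.injective_iff_surjective.mp hinj f
  exact ⟨k, by rw [← hk, hT], hk⟩

end PerronFrobenius

section Interpolation

variable {V : Type*} [Fintype V] [DecidableEq V]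

lemma interp_apply (M : Matrix V V ℝ) (m : V) (s : ℝ) (x y : V) :
    interp M m s x y = if x = m then (1 - s) * M m y + s * (if y = m then 1 else 0)
      else M x y := by
  simp only [interp, absorb, Matrix.add_apply, Matrix.smul_apply, Matrix.of_apply, smul_eq_mul]
  split_ifs with hx
  · rw [hx]
  · rw [hx]
  · ring

lemma interp_nonneg {M : Matrix V V ℝ} (hM : ∀ x y, 0 ≤ M x y) (m : V) {s : ℝ} (hs0 : 0 ≤ s)
    (hs1 : s ≤ 1) (x y : V) : 0 ≤ interp M m s x y := by
  rw [interp_apply]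
  have := mul_nonneg (sub_nonneg.mpr hs1) (hM m y)
  split_ifs
  · linarith
  · linarith
  · exact hM x y

lemma sum_interp {M : Matrix V V ℝ} (hM : ∀ x, ∑ y, M x y = 1) (m : V) (s : ℝ) (x : V) :
    ∑ y, interp M m s x y = 1 := by
  simp only [interp_apply]
  split_ifs
  · simp [Finset.sum_add_distrib, ← Finset.mul_sum, hM]
  · exact hM x

lemma discr_interp_apply {M : Matrix V V ℝ} (h0 : ∀ x y, 0 ≤ M x y)
    (hsymm : ∀ x y, M x y = M y x) (m : V) {s : ℝ} (hs0 : 0 ≤ s) (hs1 : s ≤ 1) (x y : V) :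
    discr (interp M m s) x y =
      if x = m then (if y = m then (1 - s) * M m m + s else Real.sqrt (1 - s) * M m y)
      else (if y = m then Real.sqrt (1 - s) * M x m else M x y) := by
  have h1s := sub_nonneg.mpr hs1
  simp only [discr, Matrix.of_apply, interp_apply]
  split_ifs with hx hy hy
  · rw [hx, hy, mul_one]
    exact Real.sqrt_mul_self (add_nonneg (mul_nonneg h1s (h0 m m)) hs0)
  · rw [mul_zero, add_zero, hx, hsymm y m, mul_assoc, Real.sqrt_mul h1s,
      Real.sqrt_mul_self (h0 m y)]
  · rw [mul_zero, add_zero, hy, hsymm m x, mul_left_comm, Real.sqrt_mul h1s,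
      Real.sqrt_mul_self (h0 x m)]
  · rw [hsymm y x, Real.sqrt_mul_self (h0 x y)]

/-- The (unnormalized) square root of the stationary distribution of the interpolated walk. -/
def sqrtStat (m : V) (s : ℝ) : V → ℝ := fun x => if x = m then 1 else Real.sqrt (1 - s)

lemma discr_interp_mulVec_sqrtStat {M : Matrix V V ℝ} (h0 : ∀ x y, 0 ≤ M x y)
    (hsymm : ∀ x y, M x y = M y x) (hM : ∀ x, ∑ y, M x y = 1) (m : V) {s : ℝ} (hs0 : 0 ≤ s)
    (hs1 : s ≤ 1) :
    (discr (interp M m s)).mulVec (sqrtStat m s) = sqrtStat m s := by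
  ext x
  have hsq := Real.mul_self_sqrt (sub_nonneg.mpr hs1)
  simp only [Matrix.mulVec, dotProduct, discr_interp_apply h0 hsymm m hs0 hs1, sqrtStat]
  split_ifs with hx
  · calc _ = ∑ y, ((1 - s) * M m y + if y = m then s else 0) := by
          refine Finset.sum_congr rfl fun y _ => ?_
          split_ifs with hy
          · rw [hy]; ring
          · linear_combination M m y * hsq
      _ = 1 := by
          rw [Finset.sum_add_distrib, ← Finset.mul_sum, hM]; simp
  · calc _ = ∑ y, Real.sqrt (1 - s) * M x y := by
          refine Finset.sum_congr rfl fun y _ => ?_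
          split_ifs with hy
          · rw [hy]; ring
          · ring
      _ = Real.sqrt (1 - s) := by rw [← Finset.mul_sum, hM, mul_one]

lemma discr_interp_smul_add_smul_one {M : Matrix V V ℝ} (h0 : ∀ x y, 0 ≤ M x y)
    (hsymm : ∀ x y, M x y = M y x) (m : V) {s : ℝ} (hs0 : 0 ≤ s) (hs1 : s ≤ 1) {a b : ℝ}
    (ha : 0 ≤ a) (hb : 0 ≤ b) (hab : a + b = 1) :
    discr (interp (a • M + b • (1 : Matrix V V ℝ)) m s) =
      a • discr (interp M m s) + b • (1 : Matrix V V ℝ) := by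
  have h1 : ∀ x y, 0 ≤ (1 : Matrix V V ℝ) x y := fun x y => by
    rw [Matrix.one_apply]; split_ifs <;> norm_num
  ext x y
  rw [discr_interp_apply _ _ m hs0 hs1]
  · simp only [Matrix.add_apply, Matrix.smul_apply, smul_eq_mul,
      discr_interp_apply h0 hsymm m hs0 hs1]
    split_ifs with hx hy hy
    · rw [hx, hy, Matrix.one_apply_eq]; linear_combination -s * hab
    · rw [hx, Matrix.one_apply_ne (Ne.symm hy)]; ring
    · rw [hy, Matrix.one_apply_ne hx]; ring
    · rfl
  · intro x y
    exact add_nonneg (mul_nonneg ha (h0 x y)) (mul_nonneg hb (h1 x y))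
  · intro x y
    simp only [Matrix.add_apply, Matrix.smul_apply, hsymm x y, Matrix.one_apply, eq_comm]

end Interpolation

section SimpleRandomWalk

variable {V : Type*} [Fintype V] [DecidableEq V] (G : SimpleGraph V) [DecidableRel G.Adj] (d : ℕ)

lemma Pmat_nonneg (x y : V) : 0 ≤ Pmat G d x y := by
  simp only [Pmat, Matrix.of_apply]
  split_ifs <;> positivity

lemma Pmat_symm (x y : V) : Pmat G d x y = Pmat G d y x := by
  simp only [Pmat, Matrix.of_apply, G.adj_comm]

variable {G d}

lemma sum_Pmat (hd : 1 ≤ d) (hreg : G.IsRegularOfDegree d) (x : V) : ∑ y, Pmat G d x y = 1 := by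
  have hd' : (d : ℝ) ≠ 0 := by positivity
  simp only [Pmat, Matrix.of_apply]
  rw [← Finset.sum_filter, Finset.sum_const, ← G.neighborFinset_eq_filter,
    G.card_neighborFinset_eq_degree, hreg x, nsmul_eq_mul, mul_one_div_cancel hd']

lemma discr_interp_Pmat_pos (hd : 1 ≤ d) (m : V) {s : ℝ} (hs0 : 0 ≤ s) (hs1 : s < 1) {x y : V}
    (hxy : G.Adj x y) : 0 < discr (interp (Pmat G d) m s) x y := by
  have hP : ∀ {x y}, G.Adj x y → 0 < Pmat G d x y := fun h => by
    simp only [Pmat, Matrix.of_apply, if_pos h]; positivity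
  have hsq := Real.sqrt_pos.mpr (sub_pos.mpr hs1)
  rw [discr_interp_apply (Pmat_nonneg G d) (Pmat_symm G d) m hs0 hs1.le]
  split_ifs with hx hy hy
  · exact absurd (hx.trans hy.symm) hxy.ne
  · subst hx; exact mul_pos hsq (hP hxy)
  · subst hy; exact mul_pos hsq (hP hxy)
  · exact hP hxy

end SimpleRandomWalk

section Overlaps

variable {V : Type*} [Fintype V] [DecidableEq V]

lemma sum_ite_eq_add_card_sub_one_mul (m : V) (a b : ℝ) :
    ∑ x, (if x = m then a else b) = a + ((Fintype.card V : ℝ) - 1) * b := by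
  have : ∀ x, (if x = m then a else b) = (if x = m then a - b else 0) + b := fun x => by
    split_ifs <;> ring
  simp only [this, Finset.sum_add_distrib]
  simp
  ring

lemma sqrtStat_dotProduct_self (m : V) {s : ℝ} (hs1 : s ≤ 1) :
    sqrtStat m s ⬝ᵥ sqrtStat m s = 1 + ((Fintype.card V : ℝ) - 1) * (1 - s) := by
  rw [← sum_ite_eq_add_card_sub_one_mul m]
  refine Finset.sum_congr rfl fun x _ => ?_
  simp only [sqrtStat]
  split_ifs
  · ring
  · exact Real.mul_self_sqrt (sub_nonneg.mpr hs1)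

lemma sqrtPiBar_dotProduct_self (m : V) (hN : 2 ≤ Fintype.card V) :
    sqrtPiBar m ⬝ᵥ sqrtPiBar m = 1 := by
  have hN' : (0 : ℝ) < (Fintype.card V : ℝ) - 1 := by
    have : (2 : ℝ) ≤ Fintype.card V := by exact_mod_cast hN
    linarith
  calc _ = ∑ x, (if x = m then (0 : ℝ) else 1 / ((Fintype.card V : ℝ) - 1)) := by
        refine Finset.sum_congr rfl fun x _ => ?_
        simp only [sqrtPiBar]
        split_ifs
        · ring
        · rw [div_mul_div_comm, Real.mul_self_sqrt hN'.le, one_mul]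
    _ = 1 := by rw [sum_ite_eq_add_card_sub_one_mul]; field_simp; ring

lemma sqrtStat_dotProduct_sqrtPiBar (m : V) (s : ℝ) :
    sqrtStat m s ⬝ᵥ sqrtPiBar m = Real.sqrt ((Fintype.card V : ℝ) - 1) * Real.sqrt (1 - s) := by
  calc _ = ∑ x, (if x = m then (0 : ℝ) else
          Real.sqrt (1 - s) * (1 / Real.sqrt ((Fintype.card V : ℝ) - 1))) := by
        refine Finset.sum_congr rfl fun x _ => ?_
        simp only [sqrtPiBar, sqrtStat]
        split_ifs <;> ring
    _ = _ := by
        rw [sum_ite_eq_add_card_sub_one_mul, zero_add, mul_left_comm, mul_one_div,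
          Real.div_sqrt, mul_comm]

end Overlaps

theorem statement_8 {V : Type*} [Fintype V] [DecidableEq V]
    (G : SimpleGraph V) [DecidableRel G.Adj] (d : ℕ) (m : V)
    (hd : 1 ≤ d) (hN : 3 ≤ Fintype.card V) (hconn : G.Connected)
    (hreg : G.IsRegularOfDegree d)
    (N ℓ s : ℝ) (hNdef : N = Fintype.card V) (hℓ : ℓ = d / N) (hs : s = 1 - 1 / N)
    (θh : V × V → ℝ) (φh : V × V → (V × V → ℂ))
    (hφh : IsONEigenbasis (Wmat (interp (lazyP G d ℓ) m s)) θh φh)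
    (θ' : V × V → ℝ) (φ' : V × V → (V × V → ℂ))
    (hφ' : IsONEigenbasis (Wmat (interp (Pmat G d) m s)) θ' φ') :
    QHTsq θh φh (initIp (interp (lazyP G d ℓ) m s) m) =
      ((N + 1) / N) * QHTsq θ' φ' (initIp (interp (Pmat G d) m s) m) + 1 / (2 * N - 1) := by
  have hN3 : (3 : ℝ) ≤ N := by rw [hNdef]; exact_mod_cast hN
  have hN0 : (0 : ℝ) < N := by linarith
  have hd0 : (0 : ℝ) < d := by exact_mod_cast hd
  have h1s : 1 - s = 1 / N := by rw [hs]; ring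
  have hs1 : s < 1 := by
    have : 0 < 1 / N := by positivity
    linarith
  have hs0 : 0 ≤ s := by
    have : 1 / N ≤ 1 := by rw [div_le_one hN0]; linarith
    linarith
  have hlazy : lazyP G d ℓ = (N / (N + 1)) • Pmat G d + (1 / (N + 1)) • (1 : Matrix V V ℝ) := by
    have e1 : (d : ℝ) / (d + ℓ) = N / (N + 1) := by rw [hℓ]; field_simp
    have e2 : ℓ / (d + ℓ) = 1 / (N + 1) := by rw [hℓ]; field_simp
    rw [lazyP, e1, e2]
  have hab : N / (N + 1) + 1 / (N + 1) = 1 := by field_simp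
  have hP0 := Pmat_nonneg G d
  have hPs := Pmat_symm G d
  have hP1 := sum_Pmat hd hreg
  have hDhat : discr (interp (lazyP G d ℓ) m s) =
      (N / (N + 1)) • discr (interp (Pmat G d) m s) + (1 / (N + 1)) • (1 : Matrix V V ℝ) := by
    rw [hlazy]
    exact discr_interp_smul_add_smul_one hP0 hPs m hs0 hs1.le (by positivity) (by positivity) hab
  have hL0 : ∀ x y, 0 ≤ lazyP G d ℓ x y := fun x y => by
    rw [hlazy, Matrix.add_apply, Matrix.smul_apply, Matrix.smul_apply, Matrix.one_apply]
    have := mul_nonneg (by positivity : 0 ≤ N / (N + 1)) (hP0 x y)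
    simp only [smul_eq_mul]
    split_ifs <;> positivity
  have hL1 : ∀ x, ∑ y, lazyP G d ℓ x y = 1 := fun x => by
    simp only [hlazy, Matrix.add_apply, Matrix.smul_apply, smul_eq_mul, Finset.sum_add_distrib,
      ← Finset.mul_sum, hP1, Matrix.one_apply, Finset.sum_ite_eq, Finset.mem_univ, if_true]
    linarith
  have hDg := discr_interp_mulVec_sqrtStat hP0 hPs hP1 m hs0 hs1.le
  obtain ⟨k, hgf, hk⟩ := exists_sub_mulVec_add_eq hconn (D := discr (interp (Pmat G d) m s))
    (fun x y => by simp only [discr, Matrix.of_apply, mul_comm])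
    (fun x y => Real.sqrt_nonneg _)
    (fun x y => discr_interp_Pmat_pos hd m hs0 hs1)
    (fun x => by
      simp only [sqrtStat]
      split_ifs
      · exact one_pos
      · exact Real.sqrt_pos.mpr (sub_pos.mpr hs1))
    hDg (sqrtPiBar m)
  set D := discr (interp (Pmat G d) m s)
  set g := sqrtStat m s with hg
  set c := g ⬝ᵥ k
  have hf₀ : D.mulVec (c • g) = c • g := by rw [Matrix.mulVec_smul, hDg]
  have hDhatv : ∀ v, (discr (interp (lazyP G d ℓ) m s)).mulVec v =
      (N / (N + 1)) • D.mulVec v + (1 / (N + 1)) • v := fun v => by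
    rw [hDhat, Matrix.add_mulVec, Matrix.smul_mulVec, Matrix.smul_mulVec, Matrix.one_mulVec]
  have hq := QHTsq_liftVec (interp_nonneg hP0 m hs0 hs1.le) (sum_interp hP1 m s) hφ' hf₀
    (rfl : k - D.mulVec k = _)
  have hqhat := QHTsq_liftVec (interp_nonneg hL0 m hs0 hs1.le) (sum_interp hL1 m s) hφh
    (f₀ := c • g) (k := ((N + 1) / N) • k) (r := k - D.mulVec k)
    (by rw [hDhatv, hf₀, ← add_smul, hab, one_smul])
    (by
      ext x
      simp only [hDhatv, Matrix.mulVec_smul, Pi.sub_apply, Pi.add_apply, Pi.smul_apply,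
        smul_eq_mul]
      field_simp
      ring)
  have hr : ∑ x, (k - D.mulVec k) x ^ 2 = N / (2 * N - 1) := by
    have hgg := sqrtStat_dotProduct_self m hs1.le
    have hff := sqrtPiBar_dotProduct_self m (by omega)
    have hgf' := sqrtStat_dotProduct_sqrtPiBar m s
    rw [← hg, ← hNdef, h1s] at hgg hgf'
    rw [← Real.sqrt_mul (by linarith)] at hgf'
    have hgfsq : (g ⬝ᵥ sqrtPiBar m) ^ 2 = (N - 1) * (1 / N) := by
      rw [hgf', Real.sq_sqrt (mul_nonneg (by linarith) (by positivity))]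
    have hexp : ∑ x, (k - D.mulVec k) x ^ 2 =
        sqrtPiBar m ⬝ᵥ sqrtPiBar m - 2 * c * (g ⬝ᵥ sqrtPiBar m) + c ^ 2 * (g ⬝ᵥ g) := by
      rw [← eq_sub_iff_add_eq'] at hk
      simp only [hk, dotProduct, Finset.mul_sum, ← Finset.sum_add_distrib,
        ← Finset.sum_sub_distrib]
      refine Finset.sum_congr rfl fun x _ => ?_
      simp only [Pi.sub_apply, Pi.smul_apply, smul_eq_mul]
      ring
    have h2N : 2 * N - 1 ≠ 0 := by linarith
    have hgg' : g ⬝ᵥ g = (2 * N - 1) / N := by rw [hgg]; field_simp; ring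
    have hcsq : c ^ 2 * (g ⬝ᵥ g) = (N - 1) / (2 * N - 1) := by
      rw [hgf, mul_pow, hgg'] at hgfsq
      rw [hgg']
      field_simp at hgfsq ⊢
      linear_combination hgfsq
    have hfin : ∑ x, (k - D.mulVec k) x ^ 2 = 1 - c ^ 2 * (g ⬝ᵥ g) := by
      rw [hexp, hff, hgf]; ring
    rw [hfin, hcsq, eq_div_iff h2N, sub_mul, div_mul_cancel₀ _ h2N]
    ring
  rw [hk] at hq hqhat
  rw [initIp_eq_liftVec, initIp_eq_liftVec, hq, hqhat, hr]
  have hsum : ∑ x, (((N + 1) / N) • k) x * (k - D.mulVec k) x =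
      ((N + 1) / N) * ∑ x, k x * (k - D.mulVec k) x := by
    simp only [Finset.mul_sum, Pi.smul_apply, smul_eq_mul, mul_assoc]
  have h2N : 2 * N - 1 ≠ 0 := by linarith
  rw [hsum]
  field_simp
  ring

end LQWPaper
end
end

section
/- With ℓ = d/N, for every 0 ≤ s ≤ 1 the following matrix identities hold: P̂(s) = (N/(N+1))·P(s) + (1/(N+1))·I_N and D(P̂(s)) = (N/(N+1))·D(P(s)) + (1/(N+1))·I_N; consequently, for 0 ≤ s < 1 the interpolated hitting times satisfy HT⁺(P̂(s)) = ((N+1)/N)·HT⁺(P(s)). -/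
open scoped BigOperators ComplexConjugate
open Complex

set_option linter.unusedSectionVars false

noncomputable section

namespace LQWPaper

section

variable {V : Type*} [Fintype V] [DecidableEq V]

lemma absorb_smul_add_smul_one (M : Matrix V V ℝ) (m : V) {a b : ℝ} (hab : a + b = 1) :
    absorb (a • M + b • 1) m = a • absorb M m + b • (1 : Matrix V V ℝ) := by
  ext x y
  by_cases hx : x = m
  · subst hx
    by_cases hy : y = x
    · simp [absorb, hy, hab]
    · simp [absorb, hy, Ne.symm hy]
  · simp [absorb, hx]

lemma interp_smul_add_smul_one (M : Matrix V V ℝ) (m : V) (s : ℝ) {a b : ℝ} (hab : a + b = 1) :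
    interp (a • M + b • 1) m s = a • interp M m s + b • (1 : Matrix V V ℝ) := by
  simp only [interp, absorb_smul_add_smul_one M m hab]
  module

lemma discr_smul_add_smul_one {M : Matrix V V ℝ} (hM : ∀ x, 0 ≤ M x x) {a b : ℝ}
    (ha : 0 ≤ a) (hb : 0 ≤ b) :
    discr (a • M + b • 1) = a • discr M + b • (1 : Matrix V V ℝ) := by
  ext x y
  by_cases hxy : x = y
  · subst hxy
    have h : 0 ≤ a * M x x + b := by have := hM x; positivity
    simp [discr, Real.sqrt_mul_self h, Real.sqrt_mul_self (hM x)]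
  · have h : a * M x y * (a * M y x) = a ^ 2 * (M x y * M y x) := by ring
    simp [discr, hxy, Ne.symm hxy, h, Real.sqrt_mul (sq_nonneg a), Real.sqrt_sq ha]

lemma interp_Pmat_nonneg (G : SimpleGraph V) [DecidableRel G.Adj] (d : ℕ) (m : V) {s : ℝ}
    (hs0 : 0 ≤ s) (hs1 : s ≤ 1) (x y : V) : 0 ≤ interp (Pmat G d) m s x y := by
  have hP : 0 ≤ Pmat G d x y := by
    simp only [Pmat, Matrix.of_apply]
    split_ifs <;> positivity
  have hA : 0 ≤ absorb (Pmat G d) m x y := by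
    simp only [absorb, Matrix.of_apply]
    split_ifs <;> first | exact hP | norm_num
  exact add_nonneg (mul_nonneg (sub_nonneg.2 hs1) hP) (mul_nonneg hs0 hA)

namespace IsRealONEigenbasis

variable {M : Matrix V V ℝ} {lam mu : V → ℝ} {u v : V → V → ℝ}

lemma mul_transpose (h : IsRealONEigenbasis M lam v) : Matrix.of v * (Matrix.of v).transpose = 1 := by
  ext k l
  simp [Matrix.mul_apply, h.1, Matrix.one_apply]

lemma transpose_mul (h : IsRealONEigenbasis M lam v) : (Matrix.of v).transpose * Matrix.of v = 1 :=
  mul_eq_one_comm.1 h.mul_transpose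

lemma mul_transpose_eq (h : IsRealONEigenbasis M lam v) :
    M * (Matrix.of v).transpose = (Matrix.of v).transpose * Matrix.diagonal lam := by
  ext x k
  rw [Matrix.mul_diagonal, Matrix.transpose_apply, Matrix.of_apply, mul_comm]
  exact congrFun (h.2 k) x

lemma eq_transpose_mul_diagonal_mul (h : IsRealONEigenbasis M lam v) :
    M = (Matrix.of v).transpose * Matrix.diagonal lam * Matrix.of v := by
  rw [← h.mul_transpose_eq, Matrix.mul_assoc, h.transpose_mul, Matrix.mul_one]

/-- The spectral calculus of `M` does not depend on the chosen orthonormal eigenbasis. -/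
lemma transpose_mul_diagonal_mul_eq (hv : IsRealONEigenbasis M lam v)
    (hu : IsRealONEigenbasis M mu u) (f : ℝ → ℝ) :
    (Matrix.of v).transpose * Matrix.diagonal (f ∘ lam) * Matrix.of v =
      (Matrix.of u).transpose * Matrix.diagonal (f ∘ mu) * Matrix.of u := by
  set A : Matrix V V ℝ := Matrix.of v
  set B : Matrix V V ℝ := Matrix.of u
  have hO : Matrix.diagonal lam * (A * B.transpose) = A * B.transpose * Matrix.diagonal mu := by
    have hA : Matrix.diagonal lam * A = A * M := by
      rw [hv.eq_transpose_mul_diagonal_mul, ← Matrix.mul_assoc, ← Matrix.mul_assoc,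
        hv.mul_transpose, Matrix.one_mul]
    rw [← Matrix.mul_assoc, hA, Matrix.mul_assoc, hu.mul_transpose_eq, ← Matrix.mul_assoc]
  have hf : Matrix.diagonal (f ∘ lam) * (A * B.transpose) =
      A * B.transpose * Matrix.diagonal (f ∘ mu) := by
    ext k l
    have hkl := congrFun (congrFun hO k) l
    rw [Matrix.diagonal_mul, Matrix.mul_diagonal] at hkl ⊢
    rcases eq_or_ne ((A * B.transpose) k l) 0 with h0 | h0
    · simp [h0]
    · have hlm : lam k = mu l := mul_right_cancel₀ h0 (hkl.trans (mul_comm _ _))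
      simp [hlm, mul_comm]
  calc A.transpose * Matrix.diagonal (f ∘ lam) * A
      = A.transpose * (Matrix.diagonal (f ∘ lam) * (A * B.transpose)) * B := by
        simp only [Matrix.mul_assoc]
        rw [hu.transpose_mul, Matrix.mul_one]
    _ = A.transpose * A * B.transpose * Matrix.diagonal (f ∘ mu) * B := by
        rw [hf]
        simp only [Matrix.mul_assoc]
    _ = B.transpose * Matrix.diagonal (f ∘ mu) * B := by
        rw [hv.transpose_mul, Matrix.one_mul]

lemma dotProduct_transpose_mul_diagonal_mul (g : V → ℝ) (v : V → V → ℝ) (w : V → ℝ) :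
    w ⬝ᵥ ((Matrix.of v).transpose * Matrix.diagonal g * Matrix.of v).mulVec w =
      ∑ k, g k * (∑ x, v k x * w x) ^ 2 := by
  rw [← Matrix.mulVec_mulVec, ← Matrix.mulVec_mulVec, Matrix.dotProduct_mulVec,
    Matrix.vecMul_transpose]
  refine Finset.sum_congr rfl fun k _ => ?_
  rw [Matrix.mulVec_diagonal]
  simp only [Matrix.mulVec, dotProduct, Matrix.of_apply]
  ring

lemma HTplus_eq (hv : IsRealONEigenbasis M lam v) (hu : IsRealONEigenbasis M mu u) (m : V) :
    HTplus lam v m = HTplus mu u m := by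
  have key : ∀ (nu : V → ℝ) (w : V → V → ℝ), HTplus nu w m =
      ∑ k, ((fun t : ℝ => if t = 1 then 0 else (1 - t)⁻¹) ∘ nu) k *
        (∑ x, w k x * sqrtPiBar m x) ^ 2 := by
    intro nu w
    refine Finset.sum_congr rfl fun k _ => ?_
    by_cases h : nu k = 1
    · simp [h]
    · simp [h, div_eq_inv_mul]
  rw [key, key, ← dotProduct_transpose_mul_diagonal_mul, ← dotProduct_transpose_mul_diagonal_mul,
    hv.transpose_mul_diagonal_mul_eq hu]

lemma of_smul_add_smul_one {a b : ℝ} (ha : a ≠ 0)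
    (h : IsRealONEigenbasis (a • M + b • 1) lam v) :
    IsRealONEigenbasis M (fun k => (lam k - b) / a) v := by
  refine ⟨h.1, fun k => ?_⟩
  have hk := h.2 k
  rw [Matrix.add_mulVec, Matrix.smul_mulVec, Matrix.smul_mulVec, Matrix.one_mulVec] at hk
  ext x
  have hx := congrFun hk x
  simp only [Pi.add_apply, Pi.smul_apply, smul_eq_mul] at hx ⊢
  field_simp
  linarith

end IsRealONEigenbasis

lemma HTplus_affine {a b : ℝ} (ha : a ≠ 0) (hab : a + b = 1) (lam : V → ℝ) (v : V → V → ℝ)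
    (m : V) : HTplus lam v m = a⁻¹ * HTplus (fun k => (lam k - b) / a) v m := by
  simp only [HTplus, Finset.mul_sum]
  refine Finset.sum_congr rfl fun k _ => ?_
  have hsub : 1 - (lam k - b) / a = (1 - lam k) / a := by
    field_simp
    linarith
  have hiff : (lam k - b) / a = 1 ↔ lam k = 1 := by
    rw [div_eq_one_iff_eq ha, sub_eq_iff_eq_add, hab]
  by_cases h : lam k = 1
  · rw [if_pos h, if_pos (hiff.2 h), mul_zero]
  · have h1 : 1 - lam k ≠ 0 := sub_ne_zero.2 (Ne.symm h)
    simp only [hiff, h, if_false, hsub]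
    field_simp

end

theorem statement_10 {V : Type*} [Fintype V] [DecidableEq V]
    (G : SimpleGraph V) [DecidableRel G.Adj] (d : ℕ) (m : V)
    (hd : 1 ≤ d) (hN : 3 ≤ Fintype.card V) (hconn : G.Connected)
    (hreg : G.IsRegularOfDegree d)
    (N ℓ : ℝ) (hNdef : N = Fintype.card V) (hℓ : ℓ = d / N)
    (s : ℝ) (hs0 : 0 ≤ s) (hs1 : s ≤ 1) :
    interp (lazyP G d ℓ) m s =
        (N / (N + 1)) • interp (Pmat G d) m s + (1 / (N + 1)) • (1 : Matrix V V ℝ) ∧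
    discr (interp (lazyP G d ℓ) m s) =
        (N / (N + 1)) • discr (interp (Pmat G d) m s) + (1 / (N + 1)) • (1 : Matrix V V ℝ) ∧
    (s < 1 →
      ∀ (lam : V → ℝ) (v : V → (V → ℝ)) (lamh : V → ℝ) (vh : V → (V → ℝ)),
        IsRealONEigenbasis (discr (interp (Pmat G d) m s)) lam v →
        IsRealONEigenbasis (discr (interp (lazyP G d ℓ) m s)) lamh vh →
        HTplus lamh vh m = ((N + 1) / N) * HTplus lam v m) := by
  have hNpos : 0 < N := by
    rw [hNdef]
    exact_mod_cast (by omega : 0 < Fintype.card V)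
  have hdpos : (0 : ℝ) < d := by exact_mod_cast hd
  have ha : 0 < N / (N + 1) := by positivity
  have hb : 0 ≤ 1 / (N + 1) := by positivity
  have hab : N / (N + 1) + 1 / (N + 1) = 1 := by field_simp
  have hlazy : lazyP G d ℓ = (N / (N + 1)) • Pmat G d + (1 / (N + 1)) • (1 : Matrix V V ℝ) := by
    have h1 : (d : ℝ) / (d + ℓ) = N / (N + 1) := by
      rw [hℓ]
      field_simp
    have h2 : ℓ / (d + ℓ) = 1 / (N + 1) := by
      rw [hℓ]
      field_simp
    rw [lazyP, h1, h2]
  have hinterp := interp_smul_add_smul_one (Pmat G d) m s hab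
  rw [← hlazy] at hinterp
  have hdiscr := discr_smul_add_smul_one
    (fun x => interp_Pmat_nonneg G d m hs0 hs1 x x) ha.le hb
  rw [← hinterp] at hdiscr
  refine ⟨hinterp, hdiscr, fun _ lam v lamh vh hv hvh => ?_⟩
  rw [hdiscr] at hvh
  rw [HTplus_affine ha.ne' hab, inv_div,
    (IsRealONEigenbasis.of_smul_add_smul_one ha.ne' hvh).HTplus_eq hv]

end LQWPaper
end
end

section
/- Let N ≥ 1 and let 0 < θ ≤ π/2. Define θ̂ ∈ [0, π] by cos θ̂ = (N·cos θ + 1)/(N + 1). Then (1 − 2/(N+1))·θ ≤ θ̂ ≤ θ. -/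
open scoped BigOperators ComplexConjugate
open Complex

set_option linter.unusedSectionVars false

noncomputable section

namespace LQWPaper

theorem statement_11 (N θ : ℝ) (hN : 1 ≤ N) (hθ0 : 0 < θ) (hθ1 : θ ≤ Real.pi / 2) :
    (1 - 2 / (N + 1)) * θ ≤ Real.arccos ((N * Real.cos θ + 1) / (N + 1)) ∧
      Real.arccos ((N * Real.cos θ + 1) / (N + 1)) ≤ θ := by
  have hN1 : 0 < N + 1 := by linarith
  have hcos : Real.cos θ ≤ 1 := Real.cos_le_one θ
  have hc0 : 0 ≤ 1 - 2 / (N + 1) := by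
    rw [sub_nonneg, div_le_one hN1]
    linarith
  have hc1 : 0 ≤ 2 / (N + 1) := by positivity
  constructor
  · have hconc := strictConcaveOn_cos_Icc.concaveOn.2
      (⟨by linarith [Real.pi_pos], by linarith [Real.pi_pos]⟩ :
        (0 : ℝ) ∈ Set.Icc (-(Real.pi / 2)) (Real.pi / 2))
      (⟨by linarith, hθ1⟩ : θ ∈ Set.Icc (-(Real.pi / 2)) (Real.pi / 2))
      hc1 hc0 (by ring)
    simp only [smul_eq_mul, mul_zero, zero_add, Real.cos_zero, mul_one] at hconc
    have hle : (N * Real.cos θ + 1) / (N + 1) ≤ Real.cos ((1 - 2 / (N + 1)) * θ) := by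
      refine le_trans ?_ hconc
      have hdiff : 2 / (N + 1) + (1 - 2 / (N + 1)) * Real.cos θ
          - (N * Real.cos θ + 1) / (N + 1) = (1 - Real.cos θ) / (N + 1) := by
        field_simp
        ring
      have hnonneg : 0 ≤ (1 - Real.cos θ) / (N + 1) := div_nonneg (by linarith) hN1.le
      linarith
    have harc := Real.arccos_le_arccos hle
    rwa [Real.arccos_cos (mul_nonneg hc0 hθ0.le) (by nlinarith [Real.pi_pos])] at harc
  · have hle : Real.cos θ ≤ (N * Real.cos θ + 1) / (N + 1) := by
      rw [le_div_iff₀ hN1]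
      linarith
    have harc := Real.arccos_le_arccos hle
    rwa [Real.arccos_cos hθ0.le (by linarith [Real.pi_pos])] at harc

end LQWPaper
end
end

section
/- With ℓ = d/N and s = 1 − 1/N, for every threshold angle θ₀ with 0 < θ₀ ≤ π/2 and every integer t ≥ 0, √( Σ_{k : 0 < θ_k ≤ θ₀} α_k² · |e^{i t θ_k} − e^{i t θ̂_k}|² ) ≤ (8t/(N−1)) · sin(θ₀/2). -/
open scoped BigOperators ComplexConjugate
open Complex

set_option linter.unusedSectionVars false

noncomputable section

namespace LQWPaper

/-- Parseval's identity for a real orthonormal eigenbasis. -/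
lemma IsRealONEigenbasis.sum_sq_eq {V : Type*} [Fintype V] [DecidableEq V]
    {M : Matrix V V ℝ} {lam : V → ℝ} {v : V → V → ℝ} (h : IsRealONEigenbasis M lam v)
    (w : V → ℝ) : ∑ k, (∑ x, v k x * w x) ^ 2 = ∑ x, w x ^ 2 := by
  have hmul : Matrix.of v * (Matrix.of v).transpose = 1 := by
    ext k l
    simpa [Matrix.mul_apply, Matrix.one_apply] using h.1 k l
  have hdot : (Matrix.of v).mulVec w ⬝ᵥ (Matrix.of v).mulVec w = w ⬝ᵥ w := by
    rw [Matrix.dotProduct_mulVec, ← Matrix.mulVec_transpose, Matrix.mulVec_mulVec,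
      mul_eq_one_comm.mp hmul, Matrix.one_mulVec]
  simpa [dotProduct, Matrix.mulVec, ← pow_two] using hdot

lemma sum_sqrtPiBar_sq {V : Type*} [Fintype V] [DecidableEq V] (m : V)
    (hV : 1 < Fintype.card V) : ∑ x, sqrtPiBar m x ^ 2 = 1 := by
  have hpos : (0 : ℝ) < (Fintype.card V : ℝ) - 1 := by
    have : (1 : ℝ) < Fintype.card V := by exact_mod_cast hV
    linarith
  have hterm : ∀ x, sqrtPiBar m x ^ 2
      = 1 / ((Fintype.card V : ℝ) - 1) - if x = m then 1 / ((Fintype.card V : ℝ) - 1) else 0 := by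
    intro x
    unfold sqrtPiBar
    split_ifs
    · simp
    · rw [div_pow, Real.sq_sqrt hpos.le]
      simp
  simp only [hterm, Finset.sum_sub_distrib, Finset.sum_const, Finset.sum_ite_eq', Finset.mem_univ,
    if_true, Finset.card_univ, nsmul_eq_mul]
  field_simp

lemma norm_exp_mul_I_sub_exp_mul_I_le (x y : ℝ) :
    ‖Complex.exp (x * Complex.I) - Complex.exp (y * Complex.I)‖ ≤ |x - y| := by
  have hfac : Complex.exp (x * Complex.I) - Complex.exp (y * Complex.I)
      = Complex.exp (y * Complex.I) * (Complex.exp (Complex.I * ((x - y : ℝ) : ℂ)) - 1) := by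
    rw [mul_sub, ← Complex.exp_add, mul_one]
    congr 2
    push_cast
    ring
  rw [hfac, norm_mul, Complex.norm_exp_ofReal_mul_I, one_mul]
  exact Real.norm_exp_I_mul_ofReal_sub_one_le

/-- If `0 < θ ≤ π/2` and `θ'` is the angle with `1 - cos θ' = (N / (N + 1)) (1 - cos θ)`,
then `θ'` lies below `θ` at distance at most `8 sin (θ/2) / (N + 1)`. -/
lemma abs_sub_arccos_le {N θ : ℝ} (hN : 0 ≤ N) (hθ : 0 < θ) (hθ' : θ ≤ Real.pi / 2) :
    |θ - Real.arccos ((N * Real.cos θ + 1) / (N + 1))| ≤ 8 / (N + 1) * Real.sin (θ / 2) := by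
  have hN1 : 0 < N + 1 := by linarith
  set c := (N * Real.cos θ + 1) / (N + 1) with hc
  set η := Real.arccos c with hη
  have hpi := Real.pi_pos
  have hcN : c * (N + 1) = N * Real.cos θ + 1 := div_mul_cancel₀ _ hN1.ne'
  have hle : Real.cos θ ≤ c := by
    rw [hc, le_div_iff₀ hN1]
    linarith [Real.cos_le_one θ]
  have hc1 : c ≤ 1 := by
    rw [hc, div_le_one hN1]
    nlinarith [Real.cos_le_one θ]
  have hcos : Real.cos η = c :=
    Real.cos_arccos ((Real.neg_one_le_cos θ).trans hle) hc1
  have hη0 : 0 ≤ η := Real.arccos_nonneg c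
  have hηθ : η ≤ θ := by
    rw [← Real.arccos_cos hθ.le (by linarith)]
    exact Real.arccos_le_arccos hle
  have ha : 0 < Real.sin (θ / 2) := Real.sin_pos_of_pos_of_lt_pi (by linarith) (by linarith)
  have hb : 0 ≤ Real.sin (η / 2) := Real.sin_nonneg_of_nonneg_of_le_pi (by linarith) (by linarith)
  have hsqθ : Real.cos θ = 1 - 2 * Real.sin (θ / 2) ^ 2 := by
    rw [Real.sin_sq_eq_half_sub, mul_div_cancel₀ θ two_ne_zero]
    ring
  have hsqη : c = 1 - 2 * Real.sin (η / 2) ^ 2 := by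
    rw [Real.sin_sq_eq_half_sub, mul_div_cancel₀ η two_ne_zero, hcos]
    ring
  have hsq : (Real.sin (θ / 2) ^ 2 - Real.sin (η / 2) ^ 2) * (N + 1) = Real.sin (θ / 2) ^ 2 := by
    rw [hsqθ, hsqη] at hcN
    linarith
  have hsub : (Real.sin (θ / 2) - Real.sin (η / 2)) * (N + 1) ≤ Real.sin (θ / 2) := by
    have hba : Real.sin (η / 2) ≤ Real.sin (θ / 2) :=
      Real.sin_le_sin_of_le_of_le_pi_div_two (by linarith) (by linarith) (by linarith)
    refine le_of_mul_le_mul_right ?_ ha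
    nlinarith [mul_nonneg (mul_nonneg (sub_nonneg.mpr hba) hN1.le) hb]
  have hcos4 : 1 / 2 ≤ Real.cos ((θ / 2 + η / 2) / 2) := by
    rw [← Real.cos_pi_div_three]
    exact Real.cos_le_cos_of_nonneg_of_le_pi (by linarith) (by linarith) (by linarith)
  have hsin : (θ - η) / 8 ≤ Real.sin ((θ / 2 - η / 2) / 2) := by
    refine le_trans ?_ (Real.mul_le_sin (by linarith) (by linarith))
    have h2 : 1 / 2 ≤ 2 / Real.pi := by
      rw [div_le_div_iff₀ two_pos hpi]
      linarith [Real.pi_le_four]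
    nlinarith
  have hchord : (θ - η) / 8 ≤ Real.sin (θ / 2) - Real.sin (η / 2) := by
    rw [Real.sin_sub_sin]
    nlinarith
  rw [abs_of_nonneg (sub_nonneg.mpr hηθ), div_mul_eq_mul_div, le_div_iff₀ hN1]
  nlinarith

theorem statement_12 {V : Type*} [Fintype V] [DecidableEq V]
    (G : SimpleGraph V) [DecidableRel G.Adj] (d : ℕ) (m : V)
    (hd : 1 ≤ d) (hN : 3 ≤ Fintype.card V) (hconn : G.Connected)
    (hreg : G.IsRegularOfDegree d)
    (N s : ℝ) (hNdef : N = Fintype.card V) (hs : s = 1 - 1 / N)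
    (lam : V → ℝ) (v : V → (V → ℝ))
    (hlv : IsRealONEigenbasis (discr (interp (Pmat G d) m s)) lam v)
    (α : V → ℝ) (hα : ∀ k, α k = ∑ x, v k x * sqrtPiBar m x)
    (θ : V → ℝ) (hθmem : ∀ k, θ k ∈ Set.Icc 0 Real.pi)
    (hθcos : ∀ k, lam k = Real.cos (θ k))
    (θhat : V → ℝ)
    (hθhat : ∀ k, θhat k = Real.arccos ((N * Real.cos (θ k) + 1) / (N + 1)))
    (θ₀ : ℝ) (hθ₀ : 0 < θ₀) (hθ₀' : θ₀ ≤ Real.pi / 2) (t : ℕ) :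
    Real.sqrt (∑ k, if 0 < θ k ∧ θ k ≤ θ₀ then
        α k ^ 2 * Complex.normSq (Complex.exp ((t : ℂ) * (θ k : ℂ) * Complex.I)
          - Complex.exp ((t : ℂ) * (θhat k : ℂ) * Complex.I)) else 0)
      ≤ (8 * t / (N - 1)) * Real.sin (θ₀ / 2) := by
  have hN3 : (3 : ℝ) ≤ N := by rw [hNdef]; exact_mod_cast hN
  have hpi := Real.pi_pos
  have hsin0 : 0 ≤ Real.sin (θ₀ / 2) :=
    Real.sin_nonneg_of_nonneg_of_le_pi (by linarith) (by linarith)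
  have hB : 0 ≤ (8 * t / (N - 1)) * Real.sin (θ₀ / 2) :=
    mul_nonneg (div_nonneg (by positivity) (by linarith)) hsin0
  have hα1 : ∑ k, α k ^ 2 = 1 := by
    simp only [hα]
    rw [hlv.sum_sq_eq, sum_sqrtPiBar_sq m (by omega)]
  refine Real.sqrt_le_iff.mpr ⟨hB, ?_⟩
  refine le_of_le_of_eq (Finset.sum_le_sum fun k _ => ?_)
    ((Finset.sum_mul Finset.univ (fun k => α k ^ 2) _).symm.trans (by rw [hα1, one_mul]))
  split_ifs with hk
  · refine mul_le_mul_of_nonneg_left ?_ (sq_nonneg _)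
    rw [Complex.normSq_eq_norm_sq]
    refine pow_le_pow_left₀ (norm_nonneg _) ?_ 2
    have hexp := norm_exp_mul_I_sub_exp_mul_I_le (t * θ k) (t * θhat k)
    push_cast at hexp
    have hangle := abs_sub_arccos_le (N := N) (by linarith) hk.1 (hk.2.trans hθ₀')
    rw [← hθhat k] at hangle
    have hmono : Real.sin (θ k / 2) ≤ Real.sin (θ₀ / 2) :=
      Real.sin_le_sin_of_le_of_le_pi_div_two (by linarith [hk.1]) (by linarith) (by linarith [hk.2])
    have hcoef : 8 / (N + 1) ≤ 8 / (N - 1) :=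
      div_le_div_of_nonneg_left (by norm_num) (by linarith) (by linarith)
    calc _ ≤ |t * θ k - t * θhat k| := hexp
      _ = t * |θ k - θhat k| := by rw [← mul_sub, abs_mul, Nat.abs_cast]
      _ ≤ t * (8 / (N - 1) * Real.sin (θ₀ / 2)) := by
        refine mul_le_mul_of_nonneg_left (hangle.trans ?_) (Nat.cast_nonneg t)
        exact (mul_le_mul_of_nonneg_left hmono (by positivity)).trans
          (mul_le_mul_of_nonneg_right hcoef hsin0)
      _ = _ := by ring
  · positivity

end LQWPaper
end
end
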